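/- arXiv:1808.01498 — 2 statements merged into one kernel-verified Lean document; each statement's English description precedes it below -/
import Mathlib

section
/- Let N, M : A → B be quantum channels. Then for every α ≥ 1, the amortized sandwiched Rényi channel divergence satisfies D̃_α^A(N‖M) ≤ D_max(N‖M), where D_max(N‖M) is the generalized channel divergence of the max-relative entropy. In particular, amortization collapses for the max-relative entropy: D_max^A(N‖M) = D_max(N‖M). -/
open scoped BigOperators ComplexOrder

noncomputable section

attribute [local instance] Classical.propDecidable

/-- A density matrix (quantum state): positive semidefinite with unit trace. -/
def IsDensity {ι : Type} [Fintype ι] (ρ : Matrix ι ι ℂ) : Prop :=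
  ρ.PosSemidef ∧ ρ.trace = 1

/-- The map `id_R ⊗ Φ` (for linear `Φ`), defined blockwise. -/
def idTensor {R ι κ : Type} (Φ : Matrix ι ι ℂ → Matrix κ κ ℂ)
    (X : Matrix (R × ι) (R × ι) ℂ) : Matrix (R × κ) (R × κ) ℂ :=
  fun p q => Φ (fun a b => X (p.1, a) (q.1, b)) p.2 q.2

/-- The map `Φ ⊗ id_E` (for linear `Φ`), defined blockwise. -/
def tensorId {ι κ E : Type} (Φ : Matrix ι ι ℂ → Matrix κ κ ℂ)
    (X : Matrix (ι × E) (ι × E) ℂ) : Matrix (κ × E) (κ × E) ℂ :=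
  fun p q => Φ (fun a b => X (a, p.2) (b, q.2)) p.1 q.1

/-- A quantum channel: linear, trace preserving, and completely positive. -/
structure IsChannel {ι κ : Type} [Fintype ι] [Fintype κ]
    (Φ : Matrix ι ι ℂ → Matrix κ κ ℂ) : Prop where
  linear : IsLinearMap ℂ Φ
  tracePres : ∀ X, (Φ X).trace = X.trace
  compPos : ∀ (k : ℕ) (X : Matrix (Fin k × ι) (Fin k × ι) ℂ),
      X.PosSemidef → (idTensor Φ X).PosSemidef

/-- A family of divergences, one for every finite dimension. -/
abbrev DivFam : Type 1 :=
  ∀ (ι : Type) [Fintype ι] [DecidableEq ι], Matrix ι ι ℂ → Matrix ι ι ℂ → EReal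

/-- Data processing: a generalized divergence does not increase under channels. -/
def DivDataProcessing (D : DivFam) : Prop :=
  ∀ (ι κ : Type) [Fintype ι] [DecidableEq ι] [Fintype κ] [DecidableEq κ]
    (Φ : Matrix ι ι ℂ → Matrix κ κ ℂ), IsChannel Φ →
    ∀ ρ σ : Matrix ι ι ℂ, IsDensity ρ → IsDensity σ →
      D κ (Φ ρ) (Φ σ) ≤ D ι ρ σ

/-- Faithfulness: `D(ρ‖ρ) ≤ 0` for every state `ρ`. -/
def DivFaithful (D : DivFam) : Prop :=
  ∀ (ι : Type) [Fintype ι] [DecidableEq ι] (ρ : Matrix ι ι ℂ),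
    IsDensity ρ → D ι ρ ρ ≤ 0

/-- Strong faithfulness: `D(ρ‖σ) = 0` iff `ρ = σ`. -/
def DivStronglyFaithful (D : DivFam) : Prop :=
  ∀ (ι : Type) [Fintype ι] [DecidableEq ι] (ρ σ : Matrix ι ι ℂ),
    IsDensity ρ → IsDensity σ → (D ι ρ σ = 0 ↔ ρ = σ)

/-- The generalized channel divergence `D(N‖M)`. -/
def channelDiv (D : DivFam) {ι κ : Type} [Fintype ι] [DecidableEq ι] [Fintype κ] [DecidableEq κ]
    (N M : Matrix ι ι ℂ → Matrix κ κ ℂ) : EReal :=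
  ⨆ (R : ℕ) (ρ : Matrix (Fin R × ι) (Fin R × ι) ℂ) (_ : IsDensity ρ),
    D (Fin R × κ) (idTensor N ρ) (idTensor M ρ)

/-- The amortized channel divergence `D^𝒜(N‖M)`. -/
def amortizedDiv (D : DivFam) {ι κ : Type} [Fintype ι] [DecidableEq ι] [Fintype κ] [DecidableEq κ]
    (N M : Matrix ι ι ℂ → Matrix κ κ ℂ) : EReal :=
  ⨆ (R : ℕ) (ρ : Matrix (Fin R × ι) (Fin R × ι) ℂ) (σ : Matrix (Fin R × ι) (Fin R × ι) ℂ)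
    (_ : IsDensity ρ) (_ : IsDensity σ),
      D (Fin R × κ) (idTensor N ρ) (idTensor M σ) - D (Fin R × ι) ρ σ

/-- Apply a real function to a Hermitian matrix via the spectral decomposition. -/
def hermFun {ι : Type} [Fintype ι] [DecidableEq ι] (f : ℝ → ℝ) (A : Matrix ι ι ℂ) :
    Matrix ι ι ℂ :=
  if hA : A.IsHermitian then
    (hA.eigenvectorUnitary : Matrix ι ι ℂ) *
      Matrix.diagonal (fun i => (f (hA.eigenvalues i) : ℂ)) *
      star (hA.eigenvectorUnitary : Matrix ι ι ℂ)
  else 0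

/-- Real matrix power via spectral calculus, with the generalized-inverse convention `0 ↦ 0`. -/
def matPow {ι : Type} [Fintype ι] [DecidableEq ι] (A : Matrix ι ι ℂ) (r : ℝ) : Matrix ι ι ℂ :=
  hermFun (fun x => if x = 0 then 0 else Real.rpow x r) A

/-- Matrix base-2 logarithm via spectral calculus, taken on the support. -/
def matLog2 {ι : Type} [Fintype ι] [DecidableEq ι] (A : Matrix ι ι ℂ) : Matrix ι ι ℂ :=
  hermFun (fun x => if x = 0 then 0 else Real.logb 2 x) A

/-- The projection onto the support of a Hermitian matrix. -/
def suppProj {ι : Type} [Fintype ι] [DecidableEq ι] (A : Matrix ι ι ℂ) : Matrix ι ι ℂ :=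
  hermFun (fun x => if x = 0 then 0 else 1) A

/-- `supp ρ ⊆ supp σ`, expressed (for Hermitian matrices) as kernel containment
`ker σ ⊆ ker ρ`. -/
def suppLE {ι : Type} [Fintype ι] (ρ σ : Matrix ι ι ℂ) : Prop :=
  ∀ v : ι → ℂ, σ.mulVec v = 0 → ρ.mulVec v = 0

/-- The quantum relative entropy `D(ρ‖σ) = Tr[ρ(log₂ρ − log₂σ)]`,
`+∞` if the support condition fails. -/
def relEnt {ι : Type} [Fintype ι] [DecidableEq ι] (ρ σ : Matrix ι ι ℂ) : EReal :=
  if suppLE ρ σ then (((ρ * (matLog2 ρ - matLog2 σ)).trace).re : EReal) else ⊤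

/-- `−log₂ x` as an extended real, with `−log₂ 0 = +∞`. -/
def negLog2 (x : ℝ) : EReal :=
  if x ≤ 0 then ⊤ else ((-Real.logb 2 x : ℝ) : EReal)

/-- The max-relative entropy `D_max(ρ‖σ) = inf{λ : ρ ≤ 2^λ σ}` (Loewner order). -/
def Dmax {ι : Type} [Fintype ι] (ρ σ : Matrix ι ι ℂ) : EReal :=
  ⨅ (l : ℝ) (_ : (((2 : ℝ) ^ l) • σ - ρ).PosSemidef), (l : EReal)

/-- The sandwiched Rényi divergence `D̃_α`. -/
def sandRenyi {ι : Type} [Fintype ι] [DecidableEq ι] (α : ℝ) (ρ σ : Matrix ι ι ℂ) : EReal :=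
  if α = 1 then relEnt ρ σ
  else if 1 < α ∧ ¬ suppLE ρ σ then ⊤
  else if α < 1 ∧ (ρ * σ).trace = 0 then ⊤
  else ((((α - 1)⁻¹ *
      Real.logb 2
        (((matPow (matPow σ ((1 - α) / (2 * α)) * ρ * matPow σ ((1 - α) / (2 * α))) α).trace).re)) :
        ℝ) : EReal)

/-- The Petz–Rényi divergence `D_α`. -/
def petzRenyi {ι : Type} [Fintype ι] [DecidableEq ι] (α : ℝ) (ρ σ : Matrix ι ι ℂ) : EReal :=
  if α = 0 then negLog2 (((suppProj ρ * σ).trace).re)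
  else if α = 1 then relEnt ρ σ
  else if 1 < α ∧ ¬ suppLE ρ σ then ⊤
  else if α < 1 ∧ (ρ * σ).trace = 0 then ⊤
  else ((((α - 1)⁻¹ * Real.logb 2 (((matPow ρ α * matPow σ (1 - α)).trace).re)) : ℝ) : EReal)

/-- The trace norm `‖X‖₁ = Tr √(XᴴX)`. -/
def traceNorm {ι : Type} [Fintype ι] [DecidableEq ι] (X : Matrix ι ι ℂ) : ℝ :=
  ((matPow (X.conjTranspose * X) (1/2 : ℝ)).trace).re

/-- The fidelity `F(ρ,σ) = ‖√ρ√σ‖₁²`. -/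
def matFidelity {ι : Type} [Fintype ι] [DecidableEq ι] (ρ σ : Matrix ι ι ℂ) : ℝ :=
  (traceNorm (matPow ρ (1/2 : ℝ) * matPow σ (1/2 : ℝ))) ^ 2

def relEntFam : DivFam := fun _ _ _ ρ σ => relEnt ρ σ
def DmaxFam : DivFam := fun _ _ _ ρ σ => Dmax ρ σ
def sandFam (α : ℝ) : DivFam := fun _ _ _ ρ σ => sandRenyi α ρ σ
def petzFam (α : ℝ) : DivFam := fun _ _ _ ρ σ => petzRenyi α ρ σ
/-- `D̃_{1/2}(ρ‖σ) = −log₂ F(ρ,σ)` as a divergence family. -/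
def fidDivFam : DivFam := fun _ _ _ ρ σ => negLog2 (matFidelity ρ σ)

/-- The classical-quantum state `Σ_x p(x) |x⟩⟨x| ⊗ ρ^x`. -/
def cqState {X ι : Type} [DecidableEq X] (p : X → ℝ) (ρ : X → Matrix ι ι ℂ) :
    Matrix (X × ι) (X × ι) ℂ :=
  fun a b => if a.1 = b.1 then (p a.1 : ℂ) * ρ a.1 a.2 b.2 else 0

/-- The direct-sum property of a generalized divergence on classical-quantum states. -/
def DivDirectSum (D : DivFam) : Prop :=
  ∀ (X ι : Type) [Fintype X] [DecidableEq X] [Fintype ι] [DecidableEq ι]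
    (p : X → ℝ), (∀ x, 0 ≤ p x) → (∑ x, p x = 1) →
    ∀ (ρ σ : X → Matrix ι ι ℂ), (∀ x, IsDensity (ρ x)) → (∀ x, IsDensity (σ x)) →
      D (X × ι) (cqState p ρ) (cqState p σ) = ∑ x, (p x : EReal) * D ι (ρ x) (σ x)

/-- The Kronecker (tensor) product of square matrices. -/
def mkron {ι E : Type} (A : Matrix ι ι ℂ) (B : Matrix E E ℂ) : Matrix (ι × E) (ι × E) ℂ :=
  fun p q => A p.1 q.1 * B p.2 q.2

/-- Sub-additivity of a divergence with respect to tensor-product states. -/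
def DivSubAdditive (D : DivFam) : Prop :=
  ∀ (ι E : Type) [Fintype ι] [DecidableEq ι] [Fintype E] [DecidableEq E]
    (ρ σ : Matrix ι ι ℂ) (ω τ : Matrix E E ℂ),
    IsDensity ρ → IsDensity σ → IsDensity ω → IsDensity τ →
      D (ι × E) (mkron ρ ω) (mkron σ τ) ≤ D ι ρ σ + D E ω τ

/-- The classical-quantum channel `ρ ↦ Σ_x ⟨x|ρ|x⟩ ν^x`. -/
def cqChannel {X κ : Type} [Fintype X] [Fintype κ] (ν : X → Matrix κ κ ℂ) :
    Matrix X X ℂ → Matrix κ κ ℂ :=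
  fun ρ => ∑ x, ρ x x • ν x

/-- The maximally entangled state of Schmidt rank `|ι|` on `ι × ι`. -/
def maxEnt (ι : Type) [Fintype ι] [DecidableEq ι] : Matrix (ι × ι) (ι × ι) ℂ :=
  fun p q => if p.1 = p.2 ∧ q.1 = q.2 then ((Fintype.card ι : ℂ))⁻¹ else 0

/-- An `(m+1)`-round adaptive channel discrimination protocol: registers `R_0, …, R_m`,
a shared initial state, adaptive channels between channel uses, and a final measurement. -/
structure Protocol (ι κ : Type) [Fintype ι] [DecidableEq ι] [Fintype κ] [DecidableEq κ]
    (m : ℕ) where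
  r : ℕ → ℕ
  init : Matrix (Fin (r 0) × ι) (Fin (r 0) × ι) ℂ
  init_density : IsDensity init
  adapt : ∀ i : ℕ, Matrix (Fin (r i) × κ) (Fin (r i) × κ) ℂ →
      Matrix (Fin (r (i + 1)) × ι) (Fin (r (i + 1)) × ι) ℂ
  adapt_channel : ∀ i, i < m → IsChannel (adapt i)
  meas : Matrix (Fin (r m) × κ) (Fin (r m) × κ) ℂ
  meas_psd : meas.PosSemidef
  meas_le_one : ((1 : Matrix (Fin (r m) × κ) (Fin (r m) × κ) ℂ) - meas).PosSemidef

namespace Protocol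

variable {ι κ : Type} [Fintype ι] [DecidableEq ι] [Fintype κ] [DecidableEq κ] {m : ℕ}

/-- The state on `R_i ⊗ A` just before the `(i+1)`-st channel use, when the channel is `Ch`. -/
def evolve (P : Protocol ι κ m) (Ch : Matrix ι ι ℂ → Matrix κ κ ℂ) :
    (i : ℕ) → Matrix (Fin (P.r i) × ι) (Fin (P.r i) × ι) ℂ
  | 0 => P.init
  | (i + 1) => P.adapt i (idTensor Ch (P.evolve Ch i))

/-- The final state on `R_m ⊗ B` after all `m + 1` channel uses. -/
def final (P : Protocol ι κ m) (Ch : Matrix ι ι ℂ → Matrix κ κ ℂ) :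
    Matrix (Fin (P.r m) × κ) (Fin (P.r m) × κ) ℂ :=
  idTensor Ch (P.evolve Ch m)

/-- The probability of accepting (deciding for the null hypothesis). -/
def acceptProb (P : Protocol ι κ m) (Ch : Matrix ι ι ℂ → Matrix κ κ ℂ) : ℝ :=
  ((P.meas * P.final Ch).trace).re

/-- The type I error probability `Tr[(I − Q) ρ'⁽ⁿ⁾]`. -/
def typeI (P : Protocol ι κ m) (N : Matrix ι ι ℂ → Matrix κ κ ℂ) : ℝ :=
  ((((1 : Matrix (Fin (P.r m) × κ) (Fin (P.r m) × κ) ℂ) - P.meas) * P.final N).trace).re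

/-- The type II error probability `Tr[Q τ'⁽ⁿ⁾]`. -/
def typeII (P : Protocol ι κ m) (M : Matrix ι ι ℂ → Matrix κ κ ℂ) : ℝ :=
  ((P.meas * P.final M).trace).re

end Protocol

/-- The binary (classical) state `diag(p, 1−p)`. -/
def binState (p : ℝ) : Matrix (Fin 2) (Fin 2) ℂ :=
  Matrix.diagonal (fun i => if i = 0 then (p : ℂ) else ((1 - p : ℝ) : ℂ))

/-- The binary entropy `h₂(ε)`. -/
def h2 (ε : ℝ) : ℝ := -(ε * Real.logb 2 ε) - (1 - ε) * Real.logb 2 (1 - ε)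

/-- `ζ_n(ε, N, M)` with `n = m + 1`: the optimal type II error exponent among all
`(m+1)`-round adaptive protocols with type I error at most `ε`. -/
def steinExp {ι κ : Type} [Fintype ι] [DecidableEq ι] [Fintype κ] [DecidableEq κ]
    (N M : Matrix ι ι ℂ → Matrix κ κ ℂ) (m : ℕ) (ε : ℝ) : EReal :=
  ⨆ (P : Protocol ι κ m) (_ : P.typeI N ≤ ε),
    (((m + 1 : ℝ))⁻¹ : EReal) * negLog2 (P.typeII M)

/-- Partial trace over the (left) reference system. -/
def ptraceLeft {R ι : Type} [Fintype R] (ψ : Matrix (R × ι) (R × ι) ℂ) : Matrix ι ι ℂ :=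
  fun a b => ∑ r, ψ (r, a) (r, b)

/-- The energy-constrained generalized channel divergence. -/
def eChannelDiv (D : DivFam) {ι κ : Type} [Fintype ι] [DecidableEq ι] [Fintype κ] [DecidableEq κ]
    (H : Matrix ι ι ℂ) (E : ℝ) (N M : Matrix ι ι ℂ → Matrix κ κ ℂ) : EReal :=
  ⨆ (R : ℕ) (ψ : Matrix (Fin R × ι) (Fin R × ι) ℂ) (_ : IsDensity ψ)
    (_ : ((H * ptraceLeft ψ).trace).re ≤ E),
      D (Fin R × κ) (idTensor N ψ) (idTensor M ψ)

/-- The energy-constrained amortized channel divergence. -/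
def eAmortizedDiv (D : DivFam) {ι κ : Type} [Fintype ι] [DecidableEq ι] [Fintype κ] [DecidableEq κ]
    (H : Matrix ι ι ℂ) (E : ℝ) (N M : Matrix ι ι ℂ → Matrix κ κ ℂ) : EReal :=
  ⨆ (R : ℕ) (ρ : Matrix (Fin R × ι) (Fin R × ι) ℂ) (σ : Matrix (Fin R × ι) (Fin R × ι) ℂ)
    (_ : IsDensity ρ) (_ : IsDensity σ)
    (_ : ((H * ptraceLeft ρ).trace).re ≤ E) (_ : ((H * ptraceLeft σ).trace).re ≤ E),
      D (Fin R × κ) (idTensor N ρ) (idTensor M σ) - D (Fin R × ι) ρ σ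

/-- `sup_α(ρ/σ)`: supremum of `Tr[Λρ]/Tr[Λσ]` over Hermitian `Λ` with `α⁻¹ I ≤ Λ ≤ I`. -/
def hilbertSup {ι : Type} [Fintype ι] [DecidableEq ι] (α : ℝ) (ρ σ : Matrix ι ι ℂ) : ℝ :=
  sSup { t : ℝ | ∃ Λ : Matrix ι ι ℂ, Λ.IsHermitian ∧
    (Λ - (α⁻¹ : ℝ) • (1 : Matrix ι ι ℂ)).PosSemidef ∧
    ((1 : Matrix ι ι ℂ) - Λ).PosSemidef ∧
    t = ((Λ * ρ).trace).re / ((Λ * σ).trace).re }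

/-- The Hilbert `α`-divergence `H_α(ρ‖σ)`, with `H₁(ρ‖σ) = ‖ρ−σ‖₁ / (2 ln 2)`. -/
def hilbertDiv {ι : Type} [Fintype ι] [DecidableEq ι] (α : ℝ) (ρ σ : Matrix ι ι ℂ) : ℝ :=
  if α = 1 then (2 * Real.log 2)⁻¹ * traceNorm (ρ - σ)
  else (α / (α - 1)) * Real.logb 2 (hilbertSup α ρ σ)

open Matrix

/-- Complex-valued spectral calculus of a Hermitian matrix. -/
def specFun {ι : Type} [Fintype ι] [DecidableEq ι] (f : ℝ → ℂ) (A : Matrix ι ι ℂ) :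
    Matrix ι ι ℂ :=
  if hA : A.IsHermitian then
    (hA.eigenvectorUnitary : Matrix ι ι ℂ) *
      Matrix.diagonal (fun i => f (hA.eigenvalues i)) *
      star (hA.eigenvectorUnitary : Matrix ι ι ℂ)
  else 0

section SpectralCalculus

variable {ι : Type} [Fintype ι] [DecidableEq ι] {A : Matrix ι ι ℂ}

theorem specFun_of_isHermitian (hA : A.IsHermitian) (f : ℝ → ℂ) :
    specFun f A = (hA.eigenvectorUnitary : Matrix ι ι ℂ) *
      Matrix.diagonal (fun i => f (hA.eigenvalues i)) *
      star (hA.eigenvectorUnitary : Matrix ι ι ℂ) := by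
  rw [specFun, dif_pos hA]

theorem hermFun_eq_specFun (f : ℝ → ℝ) (A : Matrix ι ι ℂ) :
    hermFun f A = specFun (fun x => (f x : ℂ)) A := rfl

theorem specFun_mul (hA : A.IsHermitian) (f g : ℝ → ℂ) :
    specFun f A * specFun g A = specFun (fun x => f x * g x) A := by
  simp only [specFun_of_isHermitian hA]
  have h : star (hA.eigenvectorUnitary : Matrix ι ι ℂ) * (hA.eigenvectorUnitary : Matrix ι ι ℂ)
    = 1 := Unitary.coe_star_mul_self _
  rw [← Matrix.diagonal_mul_diagonal]
  simp only [Matrix.mul_assoc]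
  rw [← Matrix.mul_assoc (star _) (hA.eigenvectorUnitary : Matrix ι ι ℂ), h, Matrix.one_mul]

theorem specFun_conjTranspose (f : ℝ → ℂ) (A : Matrix ι ι ℂ) :
    (specFun f A)ᴴ = specFun (fun x => star (f x)) A := by
  by_cases hA : A.IsHermitian
  · simp only [specFun_of_isHermitian hA, Matrix.star_eq_conjTranspose,
      Matrix.conjTranspose_mul, Matrix.diagonal_conjTranspose,
      Matrix.conjTranspose_conjTranspose, Matrix.mul_assoc]
    rfl
  · simp [specFun, hA]

theorem specFun_congr (hA : A.PosSemidef) {f g : ℝ → ℂ} (h : ∀ x, 0 ≤ x → f x = g x) :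
    specFun f A = specFun g A := by
  simp only [specFun_of_isHermitian hA.1]
  congr 3
  funext i
  exact h _ (hA.eigenvalues_nonneg i)

theorem specFun_ofReal (hA : A.IsHermitian) : specFun (fun x => (x : ℂ)) A = A := by
  rw [specFun_of_isHermitian hA]
  exact hA.spectral_theorem.symm

theorem specFun_posSemidef (hA : A.PosSemidef) {f : ℝ → ℂ} (h : ∀ x, 0 ≤ x → 0 ≤ f x) :
    (specFun f A).PosSemidef := by
  rw [specFun_of_isHermitian hA.1]
  exact (Matrix.PosSemidef.diagonal
    (fun i => h _ (hA.eigenvalues_nonneg i))).mul_mul_conjTranspose_same _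

theorem specFun_one (hA : A.IsHermitian) : specFun (fun _ => 1) A = 1 := by
  rw [specFun_of_isHermitian hA, Matrix.diagonal_one, Matrix.mul_one]
  exact Unitary.coe_mul_star_self _

theorem specFun_sub (f g : ℝ → ℂ) (A : Matrix ι ι ℂ) :
    specFun f A - specFun g A = specFun (fun x => f x - g x) A := by
  by_cases hA : A.IsHermitian
  · simp only [specFun_of_isHermitian hA]
    rw [← Matrix.sub_mul, ← Matrix.mul_sub, Matrix.diagonal_sub]
  · simp [specFun, hA]

theorem specFun_smul (c : ℂ) (f : ℝ → ℂ) (A : Matrix ι ι ℂ) :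
    specFun (fun x => c * f x) A = c • specFun f A := by
  by_cases hA : A.IsHermitian
  · have : (Matrix.diagonal fun i => c * f (hA.eigenvalues i)) =
        c • Matrix.diagonal fun i => f (hA.eigenvalues i) := by
      rw [← Matrix.diagonal_smul]; rfl
    simp only [specFun_of_isHermitian hA]
    rw [this, Matrix.mul_smul, Matrix.smul_mul]
  · simp [specFun, hA]

theorem one_sub_specFun_mul_conjTranspose_posSemidef (hA : A.PosSemidef)
    {f : ℝ → ℂ} (hf : ∀ x, 0 ≤ x → ‖f x‖ ≤ 1) :
    (1 - specFun f A * (specFun f A)ᴴ).PosSemidef := by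
  rw [specFun_conjTranspose, specFun_mul hA.1, ← specFun_one hA.1, specFun_sub]
  refine specFun_posSemidef hA fun x hx => ?_
  have : f x * star (f x) = ((‖f x‖ ^ 2 : ℝ) : ℂ) := by
    simpa using Complex.mul_conj' (f x)
  rw [this, sub_nonneg]
  exact_mod_cast pow_le_one₀ (norm_nonneg _) (hf x hx)

/-- Conjugation by a spectral contraction does not increase the trace. -/
theorem trace_specFun_conj_le (hA : A.PosSemidef) {B : Matrix ι ι ℂ} (hB : B.PosSemidef)
    {f : ℝ → ℂ} (hf : ∀ x, 0 ≤ x → ‖f x‖ ≤ 1) :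
    ((specFun f A)ᴴ * B * specFun f A).trace ≤ B.trace := by
  have h1 := one_sub_specFun_mul_conjTranspose_posSemidef hA hf
  obtain ⟨S, rfl⟩ : ∃ S : Matrix ι ι ℂ, B = Sᴴ * S := by
    refine ⟨specFun (fun x => (Real.sqrt x : ℂ)) B, ?_⟩
    conv_lhs => rw [← specFun_ofReal hB.1]
    rw [specFun_conjTranspose, specFun_mul hB.1]
    refine specFun_congr hB fun x hx => ?_
    simp only [Complex.star_def, Complex.conj_ofReal]
    exact_mod_cast (Real.mul_self_sqrt hx).symm
  have h2 := (h1.mul_mul_conjTranspose_same S).trace_nonneg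
  rw [Matrix.mul_sub, Matrix.sub_mul, Matrix.trace_sub, sub_nonneg, Matrix.mul_one] at h2
  calc _ = (S * (specFun f A * (specFun f A)ᴴ) * Sᴴ).trace := by
        rw [Matrix.trace_mul_comm (S * _), Matrix.mul_assoc, Matrix.trace_mul_comm]
        simp only [Matrix.mul_assoc]
    _ ≤ _ := h2
    _ = _ := Matrix.trace_mul_comm _ _

/-- Complex power `x ↦ x ^ z` with the convention that `0` is sent to `0`. -/
def suppCpow (z : ℂ) (x : ℝ) : ℂ := if x = 0 then 0 else (x : ℂ) ^ z

theorem suppCpow_add (z w : ℂ) (x : ℝ) :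
    suppCpow z x * suppCpow w x = suppCpow (z + w) x := by
  unfold suppCpow
  split_ifs with h
  · simp
  · rw [Complex.cpow_add _ _ (by exact_mod_cast h)]

theorem star_suppCpow (z : ℂ) {x : ℝ} (hx : 0 ≤ x) :
    star (suppCpow z x) = suppCpow (star z) x := by
  unfold suppCpow
  split_ifs with h
  · simp
  · have := Complex.cpow_conj (x : ℂ) z
      (by rw [Complex.arg_ofReal_of_nonneg hx]; exact Real.pi_ne_zero.symm)
    simpa using this.symm

theorem norm_suppCpow_of_re_eq_zero {z : ℂ} (hz : z.re = 0) {x : ℝ} (hx : 0 ≤ x) :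
    ‖suppCpow z x‖ ≤ 1 := by
  unfold suppCpow
  split_ifs with h
  · simp
  · rw [Complex.norm_cpow_eq_rpow_re_of_pos (lt_of_le_of_ne hx (Ne.symm h)), hz]; simp

theorem suppCpow_one (x : ℝ) : suppCpow 1 x = x := by
  unfold suppCpow
  split_ifs with h <;> simp [h]

theorem suppCpow_ofReal (r : ℝ) {x : ℝ} (hx : 0 ≤ x) :
    suppCpow r x = ((if x = 0 then 0 else Real.rpow x r : ℝ) : ℂ) := by
  unfold suppCpow
  split_ifs with h
  · simp
  · exact (Complex.ofReal_cpow hx r).symm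

/-- Complex power of a positive semidefinite matrix, taken on its support. -/
def matCpow (A : Matrix ι ι ℂ) (z : ℂ) : Matrix ι ι ℂ := specFun (suppCpow z) A

theorem matPow_eq_matCpow (hA : A.PosSemidef) (r : ℝ) : matPow A r = matCpow A r := by
  rw [matPow, hermFun_eq_specFun, matCpow]
  exact specFun_congr hA fun x hx => (suppCpow_ofReal r hx).symm

theorem matCpow_mul (hA : A.PosSemidef) (z w : ℂ) :
    matCpow A z * matCpow A w = matCpow A (z + w) := by
  rw [matCpow, matCpow, specFun_mul hA.1]
  exact specFun_congr hA fun x _ => suppCpow_add z w x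

theorem matCpow_conjTranspose (hA : A.PosSemidef) (z : ℂ) :
    (matCpow A z)ᴴ = matCpow A (star z) := by
  rw [matCpow, specFun_conjTranspose]
  exact specFun_congr hA fun x hx => star_suppCpow z hx

theorem matCpow_one (hA : A.PosSemidef) : matCpow A 1 = A := by
  conv_rhs => rw [← specFun_ofReal hA.1]
  exact specFun_congr hA fun x _ => suppCpow_one x

theorem matCpow_ofReal_posSemidef (hA : A.PosSemidef) (r : ℝ) : (matCpow A r).PosSemidef := by
  refine specFun_posSemidef hA fun x hx => ?_
  rw [suppCpow_ofReal r hx]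
  split_ifs
  · simp
  · exact_mod_cast Real.rpow_nonneg hx r

theorem trace_matCpow_conj_le (hA : A.PosSemidef) {B : Matrix ι ι ℂ} (hB : B.PosSemidef)
    {z : ℂ} (hz : z.re = 0) : ((matCpow A z)ᴴ * B * matCpow A z).trace ≤ B.trace :=
  trace_specFun_conj_le hA hB fun _ hx => norm_suppCpow_of_re_eq_zero hz hx

theorem trace_matCpow_conj_le' (hA : A.PosSemidef) {B : Matrix ι ι ℂ} (hB : B.PosSemidef)
    {z : ℂ} (hz : z.re = 0) : (matCpow A z * B * (matCpow A z)ᴴ).trace ≤ B.trace := by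
  have := trace_matCpow_conj_le hA hB (z := star z) (by simpa using hz)
  rwa [← matCpow_conjTranspose hA, Matrix.conjTranspose_conjTranspose] at this

/-- Kernel inclusion for matrices, expressed through the support projection. -/
theorem mul_matCpow_zero (hA : A.PosSemidef) {X : Matrix ι ι ℂ} (h : suppLE X A) :
    X * matCpow A 0 = X := by
  have h0 : A * (1 - matCpow A 0) = 0 := by
    rw [Matrix.mul_sub, Matrix.mul_one]
    nth_rw 2 [← matCpow_one hA]
    rw [matCpow_mul hA, add_zero, matCpow_one hA, sub_self]
  have h1 : X * (1 - matCpow A 0) = 0 := by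
    ext i j
    have h2 : A *ᵥ ((1 - matCpow A 0).col j) = 0 := by
      ext k
      exact congrFun (congrFun h0 k) j
    exact congrFun (h _ h2) i
  rw [Matrix.mul_sub, Matrix.mul_one, sub_eq_zero] at h1
  exact h1.symm

theorem matCpow_zero_mul (hA : A.PosSemidef) {X : Matrix ι ι ℂ} (hX : X.IsHermitian)
    (h : suppLE X A) : matCpow A 0 * X = X := by
  have := congrArg Matrix.conjTranspose (mul_matCpow_zero hA h)
  rwa [Matrix.conjTranspose_mul, hX.eq, matCpow_conjTranspose hA, star_zero] at this

end SpectralCalculus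
section TwoPositive

theorem posSemidef_fromBlocks_left {ι : Type} {A G B : Matrix ι ι ℂ}
    (h : (Matrix.fromBlocks A G Gᴴ B).PosSemidef) : A.PosSemidef :=
  h.submatrix Sum.inl

theorem suppLE_of_posSemidef_fromBlocks {ι : Type} [Fintype ι] {A G B : Matrix ι ι ℂ}
    (h : (Matrix.fromBlocks A G Gᴴ B).PosSemidef) : suppLE G B := by
  intro v hv
  have h0 := (h.dotProduct_mulVec_zero_iff (Sum.elim 0 v)).1 (by
    simp [Matrix.fromBlocks_mulVec, hv, dotProduct])
  have h1 := congrArg (fun w => w ∘ Sum.inl) h0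
  simpa [Matrix.fromBlocks_mulVec] using h1

variable {ι κ : Type} [Fintype ι] [DecidableEq ι] [Fintype κ] [DecidableEq κ]

/-- Two-positivity of a linear map, in block form. -/
def TwoPositive {ι κ : Type} (Φ : Matrix ι ι ℂ →ₗ[ℂ] Matrix κ κ ℂ) : Prop :=
  ∀ A G B : Matrix ι ι ℂ, (Matrix.fromBlocks A G Gᴴ B).PosSemidef →
    (Matrix.fromBlocks (Φ A) (Φ G) (Φ Gᴴ) (Φ B)).PosSemidef

theorem posSemidef_fromBlocks_gram (x y : Matrix ι ι ℂ) :
    (Matrix.fromBlocks (x * xᴴ) (x * yᴴ) (x * yᴴ)ᴴ (y * yᴴ)).PosSemidef := by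
  have := Matrix.posSemidef_self_mul_conjTranspose
    (Matrix.fromBlocks x (0 : Matrix ι ι ℂ) y (0 : Matrix ι ι ℂ))
  simpa [Matrix.fromBlocks_conjTranspose, Matrix.fromBlocks_multiply] using this

theorem posSemidef_fromBlocks_conj {A G B : Matrix ι ι ℂ}
    (h : (Matrix.fromBlocks A G Gᴴ B).PosSemidef) (L K : Matrix ι ι ℂ) :
    (Matrix.fromBlocks (L * A * Lᴴ) (L * G * K) (L * G * K)ᴴ (Kᴴ * B * K)).PosSemidef := by
  have := h.mul_mul_conjTranspose_same (Matrix.fromBlocks L 0 0 Kᴴ)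
  simpa [Matrix.fromBlocks_conjTranspose, Matrix.fromBlocks_multiply, Matrix.mul_assoc] using this

theorem norm_trace_le_of_posSemidef_fromBlocks {A G B : Matrix ι ι ℂ}
    (h : (Matrix.fromBlocks A G Gᴴ B).PosSemidef) {p : ℝ} (hA : A.trace ≤ p)
    (hB : B.trace ≤ p) : ‖G.trace‖ ≤ p := by
  obtain ⟨w, hw1, hw⟩ : ∃ w : ℂ, w * star w = 1 ∧ w * G.trace = ‖G.trace‖ := by
    by_cases h0 : G.trace = 0
    · exact ⟨1, by simp, by simp [h0]⟩
    · have hn : (‖G.trace‖ : ℂ) ≠ 0 := by exact_mod_cast norm_ne_zero_iff.2 h0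
      have hm : G.trace * star G.trace = (‖G.trace‖ : ℂ) ^ 2 := by
        simpa using Complex.mul_conj' G.trace
      refine ⟨star G.trace / ‖G.trace‖, ?_, ?_⟩
      · simp only [star_div₀, Complex.star_def, Complex.conj_ofReal] at hm ⊢
        field_simp
        rw [← hm, ← Complex.star_def, star_star, mul_comm]
      · field_simp
        linear_combination hm
  have h1 := h.conjTranspose_mul_mul_same
    (Matrix.fromBlocks (1 : Matrix ι ι ℂ) (0 : Matrix ι ι ℂ) (-(w • (1 : Matrix ι ι ℂ)))
      (0 : Matrix ι ι ℂ))
  have hw2 : w * (starRingEnd ℂ) w = 1 := hw1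
  have h2 := (posSemidef_fromBlocks_left (A := A - w • G - star w • Gᴴ + B) (G := 0) (B := 0) (by
    convert h1 using 1
    simp [Matrix.fromBlocks_conjTranspose, Matrix.fromBlocks_multiply,
      smul_smul, hw2]
    abel)).trace_nonneg
  have hs : star w * star G.trace = (‖G.trace‖ : ℂ) := by
    rw [← star_mul', hw, Complex.star_def, Complex.conj_ofReal]
  simp only [Matrix.trace_add, Matrix.trace_sub, Matrix.trace_smul, Matrix.trace_conjTranspose,
    smul_eq_mul, hw, hs] at h2
  have h3 : (0 : ℂ) ≤ ((2 * p - 2 * ‖G.trace‖ : ℝ) : ℂ) := by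
    refine h2.trans ?_
    push_cast
    rw [← sub_nonneg]
    have := add_nonneg (sub_nonneg.2 hA) (sub_nonneg.2 hB)
    convert this using 1
    ring
  have h4 : 0 ≤ 2 * p - 2 * ‖G.trace‖ := by exact_mod_cast h3
  linarith

variable {Φ : Matrix ι ι ℂ →ₗ[ℂ] Matrix κ κ ℂ}

theorem TwoPositive.map_conjTranspose {ι κ : Type} [Fintype ι] [DecidableEq ι]
    {Φ : Matrix ι ι ℂ →ₗ[ℂ] Matrix κ κ ℂ} (hΦ : TwoPositive Φ) (X : Matrix ι ι ℂ) :
    Φ Xᴴ = (Φ X)ᴴ := by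
  have h := (hΦ _ _ _ (posSemidef_fromBlocks_gram X 1)).1
  rw [Matrix.isHermitian_fromBlocks_iff] at h
  simpa using h.2.1.symm

theorem TwoPositive.map_gram {ι κ : Type} [Fintype ι] [DecidableEq ι]
    {Φ : Matrix ι ι ℂ →ₗ[ℂ] Matrix κ κ ℂ} (hΦ : TwoPositive Φ) (x y : Matrix ι ι ℂ) :
    (Matrix.fromBlocks (Φ (x * xᴴ)) (Φ (x * yᴴ)) (Φ (x * yᴴ))ᴴ (Φ (y * yᴴ))).PosSemidef := by
  rw [← hΦ.map_conjTranspose]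
  exact hΦ _ _ _ (posSemidef_fromBlocks_gram x y)

theorem posSemidef_exists_mul_self {A : Matrix ι ι ℂ} (hA : A.PosSemidef) :
    ∃ S : Matrix ι ι ℂ, S.IsHermitian ∧ S * S = A := by
  refine ⟨matCpow A ((1 / 2 : ℝ) : ℂ), (matCpow_ofReal_posSemidef hA _).1, ?_⟩
  rw [matCpow_mul hA]
  conv_rhs => rw [← matCpow_one hA]
  norm_num

theorem TwoPositive.map_posSemidef (hΦ : TwoPositive Φ) {A : Matrix ι ι ℂ} (hA : A.PosSemidef) :
    (Φ A).PosSemidef := by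
  obtain ⟨S, hS, rfl⟩ := posSemidef_exists_mul_self hA
  have := posSemidef_fromBlocks_left (hΦ.map_gram S 0)
  rwa [hS.eq] at this

/-- `Φ` maps products supported on `A` to matrices supported on `Φ A`. -/
theorem TwoPositive.suppLE_map_mul (hΦ : TwoPositive Φ) {A : Matrix ι ι ℂ} (hA : A.PosSemidef)
    (X : Matrix ι ι ℂ) : suppLE (Φ (X * A)) (Φ A) := by
  obtain ⟨S, hS, rfl⟩ := posSemidef_exists_mul_self hA
  have := suppLE_of_posSemidef_fromBlocks (hΦ.map_gram (X * S) S)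
  rwa [hS.eq, Matrix.mul_assoc] at this

end TwoPositive
section Analyticity

open scoped Matrix.Norms.L2Operator

variable {ι : Type} [Fintype ι] [DecidableEq ι] {A : Matrix ι ι ℂ}

/-- The spectral calculus of `A` as a linear function of the values on the eigenvalues. -/
def specLin (hA : A.IsHermitian) : (ι → ℂ) →ₗ[ℂ] Matrix ι ι ℂ where
  toFun d := (hA.eigenvectorUnitary : Matrix ι ι ℂ) * Matrix.diagonal d *
      star (hA.eigenvectorUnitary : Matrix ι ι ℂ)
  map_add' d e := by
    rw [← Matrix.add_mul, ← Matrix.mul_add, Matrix.diagonal_add]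
    rfl
  map_smul' c d := by
    simp [Matrix.diagonal_smul]

theorem specFun_eq_specLin (hA : A.IsHermitian) (f : ℝ → ℂ) :
    specFun f A = (specLin hA).toContinuousLinearMap (fun i => f (hA.eigenvalues i)) :=
  specFun_of_isHermitian hA f

theorem hasDerivAt_specFun (hA : A.PosSemidef) {f : ℂ → ℝ → ℂ} {f' : ℝ → ℂ} {z : ℂ}
    (h : ∀ x, 0 ≤ x → HasDerivAt (fun w => f w x) (f' x) z) :
    HasDerivAt (fun w => specFun (f w) A) (specFun f' A) z := by
  simp only [specFun_eq_specLin hA.1]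
  refine ContinuousLinearMap.hasFDerivAt _ |>.comp_hasDerivAt z ?_
  exact hasDerivAt_pi.2 fun i => h _ (hA.eigenvalues_nonneg i)

theorem hasDerivAt_suppCpow (x : ℝ) (z : ℂ) :
    HasDerivAt (fun w => suppCpow w x) (suppCpow z x * Complex.log x) z := by
  unfold suppCpow
  split_ifs with h
  · simpa using hasDerivAt_const z (0 : ℂ)
  · simpa using (hasDerivAt_id z).const_cpow (Or.inl (by exact_mod_cast h : (x : ℂ) ≠ 0))

/-- Natural logarithm of a positive semidefinite matrix, taken on its support. -/
def matLn (A : Matrix ι ι ℂ) : Matrix ι ι ℂ := specFun (fun x => Complex.log x) A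

theorem matLog2_eq_smul_matLn (hA : A.PosSemidef) :
    matLog2 A = ((Real.log 2 : ℂ))⁻¹ • matLn A := by
  rw [matLog2, hermFun_eq_specFun, matLn, ← specFun_smul]
  refine specFun_congr hA fun x hx => ?_
  split_ifs with h
  · simp [h]
  · rw [← Complex.ofReal_log hx, Real.logb]
    push_cast
    ring

theorem matLn_isHermitian (hA : A.PosSemidef) : (matLn A).IsHermitian := by
  rw [Matrix.IsHermitian, matLn, specFun_conjTranspose]
  refine specFun_congr hA fun x hx => ?_
  rw [← Complex.ofReal_log hx, Complex.star_def, Complex.conj_ofReal]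

theorem matCpow_zero_mul_matLn (hA : A.PosSemidef) : matCpow A 0 * matLn A = matLn A := by
  rw [matCpow, matLn, specFun_mul hA.1]
  refine specFun_congr hA fun x _ => ?_
  by_cases h : x = 0 <;> simp [suppCpow, h]

theorem mul_matLn_comm (hA : A.PosSemidef) : A * matLn A = matLn A * A := by
  nth_rw 1 [← specFun_ofReal hA.1]
  nth_rw 4 [← specFun_ofReal hA.1]
  rw [matLn, specFun_mul hA.1, specFun_mul hA.1]
  exact specFun_congr hA fun x _ => mul_comm _ _

theorem hasDerivAt_matCpow_comp (hA : A.PosSemidef) {g : ℂ → ℂ} {g' z : ℂ}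
    (hg : HasDerivAt g g' z) :
    HasDerivAt (fun w => matCpow A (g w)) (g' • (matCpow A (g z) * matLn A)) z := by
  rw [matCpow, matLn, specFun_mul hA.1, ← specFun_smul]
  refine hasDerivAt_specFun hA fun x _ => ?_
  exact ((hasDerivAt_suppCpow x (g z)).comp z hg).congr_deriv (by ring)

theorem exists_norm_matCpow_le (hA : A.PosSemidef) (r : ℝ) :
    ∃ C, ∀ z : ℂ, |z.re| ≤ r → ‖matCpow A z‖ ≤ C := by
  refine ⟨‖(specLin hA.1).toContinuousLinearMap‖ *
    ∑ i, Real.exp (|Real.log (hA.1.eigenvalues i)| * r), fun z hz => ?_⟩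
  rw [matCpow, specFun_eq_specLin hA.1]
  refine (ContinuousLinearMap.le_opNorm _ _).trans ?_
  gcongr
  refine (pi_norm_le_iff_of_nonneg (Finset.sum_nonneg fun i _ => (Real.exp_pos _).le)).2
    fun i => ?_
  refine le_trans ?_ (Finset.single_le_sum
    (f := fun i => Real.exp (|Real.log (hA.1.eigenvalues i)| * r))
    (fun j _ => (Real.exp_pos _).le) (Finset.mem_univ i))
  have h0 := hA.eigenvalues_nonneg i
  simp only [suppCpow]
  split_ifs with h
  · simpa using (Real.exp_pos _).le
  · have hp := lt_of_le_of_ne h0 (Ne.symm h)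
    rw [Complex.norm_cpow_eq_rpow_re_of_pos hp, Real.rpow_def_of_pos hp]
    refine Real.exp_le_exp.2 ((le_abs_self _).trans ?_)
    rw [abs_mul]
    gcongr

end Analyticity

section Interpolation

open scoped Matrix.Norms.L2Operator

variable {ι κ : Type} [Fintype ι] [DecidableEq ι] [Fintype κ] [DecidableEq κ]
  {Φ : Matrix ι ι ℂ →ₗ[ℂ] Matrix κ κ ℂ} {σ X : Matrix ι ι ℂ} {τ Z : Matrix κ κ ℂ} {a c p q : ℝ}

/-- The analytic family interpolating between the trace-norm and the operator-norm bound. -/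
def interpFun (Φ : Matrix ι ι ℂ →ₗ[ℂ] Matrix κ κ ℂ) (σ X : Matrix ι ι ℂ) (τ Z : Matrix κ κ ℂ)
    (a : ℝ) (z : ℂ) : ℂ :=
  (Φ (matCpow σ (z / 2) * matCpow X (a * (1 - z)) * matCpow σ (z / 2)) *
    (matCpow τ (-z / 2) * matCpow Z (a * z) * matCpow τ (-z / 2))).trace

theorem norm_interpFun_le_of_re_eq_zero (hΦ : TwoPositive Φ)
    (hΦt : ∀ Y, (Φ Y).trace = Y.trace) (hσ : σ.PosSemidef) (hX : X.PosSemidef)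
    (hτ : τ.PosSemidef) (hZ : Z.PosSemidef) (hp : (matCpow X a).trace ≤ p) {z : ℂ}
    (hz : z.re = 0) : ‖interpFun Φ σ X τ Z a z‖ ≤ p := by
  have hs : z + star z = 0 := by
    apply Complex.ext <;> simp [hz]
  set S := matCpow σ (z / 2) with hS
  set R₁ := matCpow X ((a : ℂ) / 2) with hR₁
  set R₂ := matCpow X ((a : ℂ) / 2 - a * z) with hR₂
  set T := matCpow τ (-z / 2) with hT
  set Q := matCpow Z (a * z) with hQ
  have hR : matCpow X (a * (1 - z)) = R₁ * R₂ := by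
    rw [hR₁, hR₂, matCpow_mul hX]; congr 1; ring
  have hRR₁ : R₁ * R₁ᴴ = matCpow X a := by
    rw [hR₁, matCpow_conjTranspose hX, matCpow_mul hX]; congr 1; simp
  have hRR₂ : R₂ᴴ * R₂ = matCpow X a := by
    rw [hR₂, matCpow_conjTranspose hX, matCpow_mul hX]; congr 1
    simp only [star_sub, star_div₀, star_mul', Complex.star_def, Complex.conj_ofReal] at hs ⊢
    simp only [map_ofNat]
    linear_combination (-(a : ℂ)) * hs
  have hblk := posSemidef_fromBlocks_conj (hΦ.map_gram (S * R₁) ((R₂ * S)ᴴ)) 1 (T * Q * T)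
  have hG : interpFun Φ σ X τ Z a z =
      (1 * Φ (S * R₁ * ((R₂ * S)ᴴ)ᴴ) * (T * Q * T)).trace := by
    rw [interpFun, hR, Matrix.one_mul, Matrix.conjTranspose_conjTranspose]
    simp only [Matrix.mul_assoc]
    rfl
  have hXa : (matCpow X a).PosSemidef := matCpow_ofReal_posSemidef hX a
  have hTz : (-z / 2).re = 0 := by simp [hz]
  have hSz : (z / 2).re = 0 := by simp [hz]
  have hQz : ((a : ℂ) * z).re = 0 := by simp [hz]
  rw [hG]
  refine norm_trace_le_of_posSemidef_fromBlocks hblk ?_ ?_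
  · rw [Matrix.one_mul, Matrix.conjTranspose_one, Matrix.mul_one, hΦt]
    refine le_trans ?_ hp
    have := trace_matCpow_conj_le' hσ hXa hSz
    rwa [← hRR₁, ← Matrix.mul_assoc, ← hS, Matrix.mul_assoc (S * R₁),
      ← Matrix.conjTranspose_mul, hRR₁] at this
  · set B := Φ ((R₂ * S)ᴴ * ((R₂ * S)ᴴ)ᴴ) with hB
    have hB0 : B.PosSemidef := hΦ.map_posSemidef (Matrix.posSemidef_self_mul_conjTranspose _)
    have h1 := hB0.conjTranspose_mul_mul_same T
    have h2 := h1.conjTranspose_mul_mul_same Q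
    have e : (T * Q * T)ᴴ * B * (T * Q * T) = Tᴴ * (Qᴴ * (Tᴴ * B * T) * Q) * T := by
      simp only [Matrix.conjTranspose_mul, Matrix.mul_assoc]
    rw [e]
    refine (trace_matCpow_conj_le hτ h2 hTz).trans ((trace_matCpow_conj_le hZ h1 hQz).trans
      ((trace_matCpow_conj_le hτ hB0 hTz).trans ?_))
    rw [hB, hΦt, Matrix.conjTranspose_conjTranspose]
    refine le_trans ?_ hp
    have := trace_matCpow_conj_le hσ hXa hSz
    rwa [← hRR₂, ← Matrix.mul_assoc, ← hS, Matrix.mul_assoc (Sᴴ * R₂ᴴ),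
      ← Matrix.conjTranspose_mul, hRR₂] at this

theorem trace_mul_matCpow_zero_mul_le (hτ : τ.PosSemidef) (Q : Matrix κ κ ℂ) :
    (Q * matCpow τ 0 * Qᴴ).trace ≤ (Qᴴ * Q).trace := by
  have h := trace_matCpow_conj_le hτ (Matrix.posSemidef_conjTranspose_mul_self Q)
    (z := 0) Complex.zero_re
  refine le_of_eq_of_le ?_ h
  have e : matCpow τ 0 = matCpow τ 0 * (matCpow τ 0)ᴴ := by
    rw [matCpow_conjTranspose hτ, star_zero, matCpow_mul hτ, add_zero]
  rw [Matrix.mul_assoc, Matrix.mul_assoc, Matrix.trace_mul_comm (_ᴴ)]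
  rw [Matrix.trace_mul_comm]
  conv_lhs => rw [e]
  simp only [Matrix.mul_assoc]
  rw [Matrix.trace_mul_comm]
  simp only [Matrix.mul_assoc]
  rw [Matrix.trace_mul_comm]
  simp only [Matrix.mul_assoc]

theorem norm_interpFun_le_of_re_eq_one (hΦ : TwoPositive Φ)
    (hσ : σ.PosSemidef) (hX : X.PosSemidef)
    (hτ : τ.PosSemidef) (hZ : Z.PosSemidef) (hc : 0 ≤ c) (hle : (c • τ - Φ σ).PosSemidef)
    (hq : (matCpow Z a).trace ≤ q) {z : ℂ}
    (hz : z.re = 1) : ‖interpFun Φ σ X τ Z a z‖ ≤ c * q := by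
  have hs : z + star z = 2 := by
    apply Complex.ext <;> norm_num [hz]
  set S := matCpow σ (z / 2) with hS
  set R := matCpow X (a * (1 - z)) with hR
  set T := matCpow τ (-z / 2) with hT
  set Q₁ := matCpow Z ((a : ℂ) / 2) with hQ₁
  set Q₂ := matCpow Z (a * z - (a : ℂ) / 2) with hQ₂
  have hQ : matCpow Z (a * z) = Q₁ * Q₂ := by
    rw [hQ₁, hQ₂, matCpow_mul hZ]; congr 1; ring
  have hQQ₁ : Q₁ * Q₁ᴴ = matCpow Z a := by
    rw [hQ₁, matCpow_conjTranspose hZ, matCpow_mul hZ]; congr 1; simp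
  have hQQ₂ : Q₂ᴴ * Q₂ = matCpow Z a := by
    rw [hQ₂, matCpow_conjTranspose hZ, matCpow_mul hZ]; congr 1
    simp only [star_sub, star_div₀, star_mul', Complex.star_def, Complex.conj_ofReal] at hs ⊢
    simp only [map_ofNat]
    linear_combination (a : ℂ) * hs
  have hSS : S * Sᴴ = σ := by
    rw [hS, matCpow_conjTranspose hσ, matCpow_mul hσ]
    conv_rhs => rw [← matCpow_one hσ]
    congr 1
    simp only [star_div₀, Complex.star_def, map_ofNat] at hs ⊢
    linear_combination hs / 2
  have hSS' : Sᴴ * S = σ := by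
    rw [hS, matCpow_conjTranspose hσ, matCpow_mul hσ]
    conv_rhs => rw [← matCpow_one hσ]
    congr 1
    simp only [star_div₀, Complex.star_def, map_ofNat] at hs ⊢
    linear_combination hs / 2
  have hTT : T * τ * Tᴴ = matCpow τ 0 := by
    rw [hT, matCpow_conjTranspose hτ]
    nth_rw 2 [← matCpow_one hτ]
    rw [matCpow_mul hτ, matCpow_mul hτ]
    congr 1
    simp only [star_div₀, star_neg, Complex.star_def, map_ofNat] at hs ⊢
    linear_combination -hs / 2
  have hTT' : Tᴴ * τ * T = matCpow τ 0 := by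
    rw [hT, matCpow_conjTranspose hτ]
    nth_rw 2 [← matCpow_one hτ]
    rw [matCpow_mul hτ, matCpow_mul hτ]
    congr 1
    simp only [star_div₀, star_neg, Complex.star_def, map_ofNat] at hs ⊢
    linear_combination -hs / 2
  have hRR : (1 - R * Rᴴ).PosSemidef :=
    one_sub_specFun_mul_conjTranspose_posSemidef hX fun x hx =>
      norm_suppCpow_of_re_eq_zero (by simp [hz]) hx
  have hA : (c • τ - Φ ((S * R) * (S * R)ᴴ)).PosSemidef := by
    have h := hle.add (hΦ.map_posSemidef (hRR.mul_mul_conjTranspose_same S))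
    rw [Matrix.mul_sub, Matrix.sub_mul, Matrix.mul_one, hSS, map_sub, sub_add_sub_cancel] at h
    simpa only [Matrix.conjTranspose_mul, Matrix.mul_assoc] using h
  have hB : (c • τ - Φ (Sᴴ * Sᴴᴴ)).PosSemidef := by
    rwa [Matrix.conjTranspose_conjTranspose, hSS']
  have hblk := posSemidef_fromBlocks_conj (hΦ.map_gram (S * R) Sᴴ) (Q₂ * T) (T * Q₁)
  have hG : interpFun Φ σ X τ Z a z =
      (Q₂ * T * Φ (S * R * (Sᴴ)ᴴ) * (T * Q₁)).trace := by
    rw [interpFun, hQ, Matrix.conjTranspose_conjTranspose, Matrix.mul_assoc (Q₂ * T),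
      Matrix.trace_mul_comm (Q₂ * T)]
    simp only [Matrix.mul_assoc]
    rfl
  have key : ∀ (L : Matrix κ κ ℂ) (A : Matrix κ κ ℂ), (c • τ - A).PosSemidef →
      (L * A * Lᴴ).trace ≤ c * (L * τ * Lᴴ).trace := by
    intro L A h
    have := (h.mul_mul_conjTranspose_same L).trace_nonneg
    rw [Matrix.mul_sub, Matrix.sub_mul, Matrix.trace_sub, sub_nonneg] at this
    simpa using this
  have hc' : (0 : ℂ) ≤ c := by exact_mod_cast hc
  rw [hG]
  refine norm_trace_le_of_posSemidef_fromBlocks hblk ?_ ?_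
  · refine (key _ _ hA).trans ?_
    rw [Complex.ofReal_mul]
    refine mul_le_mul_of_nonneg_left ?_ hc'
    refine le_trans ?_ hq
    have := trace_mul_matCpow_zero_mul_le hτ Q₂
    rw [← hTT, hQQ₂] at this
    simpa only [Matrix.conjTranspose_mul, Matrix.mul_assoc] using this
  · have h := key (T * Q₁)ᴴ _ hB
    rw [Matrix.conjTranspose_conjTranspose (T * Q₁)] at h
    refine h.trans ?_
    rw [Complex.ofReal_mul]
    refine mul_le_mul_of_nonneg_left ?_ hc'
    refine le_trans ?_ hq
    have := trace_mul_matCpow_zero_mul_le hτ Q₁ᴴ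
    rw [← hTT', Matrix.conjTranspose_conjTranspose, hQQ₁] at this
    simpa only [Matrix.conjTranspose_mul, Matrix.mul_assoc] using this

theorem differentiable_interpFun (hσ : σ.PosSemidef) (hX : X.PosSemidef)
    (hτ : τ.PosSemidef) (hZ : Z.PosSemidef) : Differentiable ℂ (interpFun Φ σ X τ Z a) := by
  intro z
  have d : ∀ {n : Type} [Fintype n] [DecidableEq n] {A : Matrix n n ℂ} (_ : A.PosSemidef)
      {g : ℂ → ℂ} (_ : DifferentiableAt ℂ g z), DifferentiableAt ℂ (fun w => matCpow A (g w)) z :=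
    fun hA _ hg => (hasDerivAt_matCpow_comp hA hg.hasDerivAt).differentiableAt
  have h1 : DifferentiableAt ℂ (fun z => Φ.toContinuousLinearMap
      (matCpow σ (z / 2) * matCpow X (a * (1 - z)) * matCpow σ (z / 2))) z :=
    (ContinuousLinearMap.differentiableAt _).comp z
      (((d hσ (by fun_prop)).mul (d hX (by fun_prop))).mul (d hσ (by fun_prop)))
  have h2 : DifferentiableAt ℂ (fun z =>
      matCpow τ (-z / 2) * matCpow Z (a * z) * matCpow τ (-z / 2)) z :=
    ((d hτ (by fun_prop)).mul (d hZ (by fun_prop))).mul (d hτ (by fun_prop))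
  exact (ContinuousLinearMap.differentiableAt
    (Matrix.traceLinearMap κ ℂ ℂ).toContinuousLinearMap).comp z (h1.mul h2)

theorem exists_norm_interpFun_le (hσ : σ.PosSemidef) (hX : X.PosSemidef)
    (hτ : τ.PosSemidef) (hZ : Z.PosSemidef) :
    ∃ C, ∀ z : ℂ, 0 ≤ z.re → z.re ≤ 1 → ‖interpFun Φ σ X τ Z a z‖ ≤ C := by
  obtain ⟨C₁, h₁⟩ := exists_norm_matCpow_le hσ 1
  obtain ⟨C₂, h₂⟩ := exists_norm_matCpow_le hX |a|
  obtain ⟨C₃, h₃⟩ := exists_norm_matCpow_le hτ 1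
  obtain ⟨C₄, h₄⟩ := exists_norm_matCpow_le hZ |a|
  refine ⟨‖(Matrix.traceLinearMap κ ℂ ℂ).toContinuousLinearMap‖ *
    (‖Φ.toContinuousLinearMap‖ * (C₁ * C₂ * C₁) * (C₃ * C₄ * C₃)), fun z hz0 hz1 => ?_⟩
  have g₁ := h₁ (z / 2) (by simp [abs_le]; constructor <;> linarith)
  have g₂ := h₂ (a * (1 - z)) (by
    simp [abs_mul]
    exact mul_le_of_le_one_right (abs_nonneg _) (abs_le.2 ⟨by linarith, by linarith⟩))
  have g₃ := h₃ (-z / 2) (by simp [abs_le]; constructor <;> linarith)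
  have g₄ := h₄ (a * z) (by
    simp [abs_mul]
    exact mul_le_of_le_one_right (abs_nonneg _) (abs_le.2 ⟨by linarith, by linarith⟩))
  have n₁ := (norm_nonneg _).trans g₁
  have n₂ := (norm_nonneg _).trans g₂
  have n₃ := (norm_nonneg _).trans g₃
  have n₄ := (norm_nonneg _).trans g₄
  refine (ContinuousLinearMap.le_opNorm
    (Matrix.traceLinearMap κ ℂ ℂ).toContinuousLinearMap _).trans ?_
  gcongr
  refine (norm_mul_le _ _).trans ?_
  gcongr
  · refine (ContinuousLinearMap.le_opNorm Φ.toContinuousLinearMap _).trans ?_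
    gcongr
    refine (norm_mul_le _ _).trans ?_
    gcongr
    refine (norm_mul_le _ _).trans ?_
    gcongr
  · refine (norm_mul_le _ _).trans ?_
    gcongr
    refine (norm_mul_le _ _).trans ?_
    gcongr

theorem norm_interpFun_ofReal_le (hΦ : TwoPositive Φ)
    (hΦt : ∀ Y, (Φ Y).trace = Y.trace) (hσ : σ.PosSemidef) (hX : X.PosSemidef)
    (hτ : τ.PosSemidef) (hZ : Z.PosSemidef) (hc : 0 ≤ c) (hle : (c • τ - Φ σ).PosSemidef)
    (hp : (matCpow X a).trace ≤ p) (hq : (matCpow Z a).trace ≤ q) {s : ℝ} (hs0 : 0 ≤ s)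
    (hs1 : s ≤ 1) : ‖interpFun Φ σ X τ Z a s‖ ≤ p ^ (1 - s) * (c * q) ^ s := by
  obtain ⟨C, hC⟩ := exists_norm_interpFun_le (Φ := Φ) (a := a) hσ hX hτ hZ
  have h := Complex.HadamardThreeLines.norm_le_interp_of_mem_verticalClosedStrip'
    (f := interpFun Φ σ X τ Z a) (z := (s : ℂ)) (l := 0) (u := 1) (a := p) (b := c * q)
    zero_lt_one (by simpa [Complex.HadamardThreeLines.verticalClosedStrip] using ⟨hs0, hs1⟩)
    (differentiable_interpFun hσ hX hτ hZ).diffContOnCl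
    ⟨C, by
      rintro _ ⟨z, hz, rfl⟩
      exact hC z hz.1 hz.2⟩
    (fun z hz => norm_interpFun_le_of_re_eq_zero hΦ hΦt hσ hX hτ hZ hp hz)
    (fun z hz => norm_interpFun_le_of_re_eq_one hΦ hσ hX hτ hZ hc hle hq hz)
  simpa using h

end Interpolation
section SupportInclusion

variable {ι κ : Type} [Fintype ι] [DecidableEq ι] [Fintype κ] [DecidableEq κ]
  {Φ : Matrix ι ι ℂ →ₗ[ℂ] Matrix κ κ ℂ} {ρ σ : Matrix ι ι ℂ} {τ : Matrix κ κ ℂ} {c : ℝ}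

theorem suppLE_of_smul_sub_posSemidef {ι : Type} [Fintype ι] {σ : Matrix ι ι ℂ}
    (hσ : σ.PosSemidef) {τ : Matrix ι ι ℂ}
    (h : (c • τ - σ).PosSemidef) : suppLE σ τ := by
  intro v hv
  refine (hσ.dotProduct_mulVec_zero_iff v).1 (le_antisymm ?_ (hσ.dotProduct_mulVec_nonneg v))
  have := h.dotProduct_mulVec_nonneg v
  simpa [Matrix.sub_mulVec, Matrix.smul_mulVec, hv] using this

theorem TwoPositive.suppLE_map (hΦ : TwoPositive Φ) (hσ : σ.PosSemidef) (h : suppLE ρ σ) :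
    suppLE (Φ ρ) (Φ σ) := by
  have e : ρ * matCpow σ (-1) * σ = ρ := by
    nth_rw 2 [← matCpow_one hσ]
    rw [Matrix.mul_assoc, matCpow_mul hσ, neg_add_cancel, mul_matCpow_zero hσ h]
  have := hΦ.suppLE_map_mul hσ (ρ * matCpow σ (-1))
  rwa [e] at this

theorem TwoPositive.suppLE_map_of_le (hΦ : TwoPositive Φ) (hσ : σ.PosSemidef)
    (hle : (c • τ - Φ σ).PosSemidef) (h : suppLE ρ σ) : suppLE (Φ ρ) τ := fun v hv =>
  hΦ.suppLE_map hσ h v (suppLE_of_smul_sub_posSemidef (hΦ.map_posSemidef hσ) hle v hv)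

theorem trace_eq_ofReal_re {ι : Type} [Fintype ι] {A : Matrix ι ι ℂ} (hA : A.PosSemidef) :
    A.trace = (A.trace.re : ℂ) :=
  Complex.ext rfl (by simpa using (Complex.nonneg_iff.1 hA.trace_nonneg).2.symm)

end SupportInclusion

section SandwichedRenyi

variable {ι κ : Type} [Fintype ι] [DecidableEq ι] [Fintype κ] [DecidableEq κ]
  {Φ : Matrix ι ι ℂ →ₗ[ℂ] Matrix κ κ ℂ} {ρ σ : Matrix ι ι ℂ} {τ : Matrix κ κ ℂ}

theorem matPow_conj_posSemidef (hσ : σ.PosSemidef) (hρ : ρ.PosSemidef) (r : ℝ) :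
    (matPow σ r * ρ * matPow σ r).PosSemidef := by
  rw [matPow_eq_matCpow hσ]
  have h := hρ.mul_mul_conjTranspose_same (matCpow σ r)
  rwa [(matCpow_ofReal_posSemidef hσ r).1.eq] at h

theorem matCpow_mul_matPow_conj_mul (hσ : σ.PosSemidef) (hρ : ρ.PosSemidef) (h : suppLE ρ σ)
    (r : ℝ) : matCpow σ r * (matPow σ (-r) * ρ * matPow σ (-r)) * matCpow σ r = ρ := by
  rw [matPow_eq_matCpow hσ]
  have e1 : matCpow σ r * matCpow σ ((-r : ℝ) : ℂ) = matCpow σ 0 := by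
    rw [matCpow_mul hσ]; simp
  have e2 : matCpow σ ((-r : ℝ) : ℂ) * matCpow σ r = matCpow σ 0 := by
    rw [matCpow_mul hσ]; simp
  calc _ = (matCpow σ r * matCpow σ ((-r : ℝ) : ℂ)) * ρ *
        (matCpow σ ((-r : ℝ) : ℂ) * matCpow σ r) := by simp only [Matrix.mul_assoc]
    _ = ρ := by rw [e1, e2, matCpow_zero_mul hσ hρ.1 h, mul_matCpow_zero hσ h]

theorem sandRenyi_map_le_of_one_lt (hΦ : TwoPositive Φ) (hΦt : ∀ Y, (Φ Y).trace = Y.trace)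
    {α : ℝ} (hα : 1 < α) (hρ : IsDensity ρ) (hσ : σ.PosSemidef) (hτ : τ.PosSemidef) {l : ℝ}
    (hle : ((2 : ℝ) ^ l • τ - Φ σ).PosSemidef) :
    sandRenyi α (Φ ρ) τ ≤ sandRenyi α ρ σ + l := by
  unfold sandRenyi
  rw [if_neg hα.ne', if_neg hα.ne']
  by_cases hs : suppLE ρ σ
  swap
  · rw [if_pos (⟨hα, hs⟩ : 1 < α ∧ ¬ suppLE ρ σ), EReal.top_add_coe]
    exact le_top
  have hs' : suppLE (Φ ρ) τ := hΦ.suppLE_map_of_le hσ hle hs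
  rw [if_neg (fun h => h.2 hs'), if_neg (fun h => absurd h.1 (not_lt.2 hα.le)),
    if_neg (fun h => h.2 hs), if_neg (fun h => absurd h.1 (not_lt.2 hα.le))]
  have hα0 : 0 < α := by linarith
  set s : ℝ := (α - 1) / α with hsdef
  have hs0 : 0 ≤ s := div_nonneg (by linarith) hα0.le
  have hs1 : s < 1 := by rw [hsdef, div_lt_one hα0]; linarith
  have hexp : (1 - α) / (2 * α) = -(s / 2) := by rw [hsdef]; field_simp; ring
  rw [hexp]
  have hΦρ := hΦ.map_posSemidef hρ.1
  set X := matPow σ (-(s / 2)) * ρ * matPow σ (-(s / 2)) with hXdef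
  set Z := matPow τ (-(s / 2)) * Φ ρ * matPow τ (-(s / 2)) with hZdef
  have hX : X.PosSemidef := matPow_conj_posSemidef hσ hρ.1 _
  have hZ : Z.PosSemidef := matPow_conj_posSemidef hτ hΦρ _
  rw [matPow_eq_matCpow hX, matPow_eq_matCpow hZ]
  have hp := trace_eq_ofReal_re (matCpow_ofReal_posSemidef hX α)
  have hq := trace_eq_ofReal_re (matCpow_ofReal_posSemidef hZ α)
  have hp0 := (Complex.nonneg_iff.1 (matCpow_ofReal_posSemidef hX α).trace_nonneg).1
  have hq0 := (Complex.nonneg_iff.1 (matCpow_ofReal_posSemidef hZ α).trace_nonneg).1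
  set p := (matCpow X α).trace.re
  set q := (matCpow Z α).trace.re
  have hc : (0 : ℝ) < 2 ^ l := Real.rpow_pos_of_pos two_pos l
  have hmain := norm_interpFun_ofReal_le hΦ hΦt hσ hX hτ hZ hc.le hle hp.le hq.le hs0 hs1.le
  have hαs : (α : ℂ) * s = α - 1 := by
    rw [hsdef]; push_cast
    have : (α : ℂ) ≠ 0 := by exact_mod_cast hα0.ne'
    field_simp
  have hF : interpFun Φ σ X τ Z α s = q := by
    have e1 : (α : ℂ) * (1 - s) = 1 := by rw [mul_sub, hαs]; ring
    have e2 : (s : ℂ) / 2 = ((s / 2 : ℝ) : ℂ) := by push_cast; rfl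
    have e3 : -(s : ℂ) / 2 = ((-(s / 2) : ℝ) : ℂ) := by push_cast; ring
    rw [interpFun, e1, matCpow_one hX, hαs, e2, e3, hXdef,
      matCpow_mul_matPow_conj_mul hσ hρ.1 hs, ← matPow_eq_matCpow hτ, ← Matrix.mul_assoc,
      Matrix.trace_mul_comm, ← Matrix.mul_assoc, ← Matrix.mul_assoc, ← hZdef]
    nth_rw 1 [← matCpow_one hZ]
    rw [matCpow_mul hZ, add_sub_cancel, ← hq]
  rw [hF, Complex.norm_real, Real.norm_of_nonneg hq0] at hmain
  have hqpos : 0 < q := by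
    refine lt_of_le_of_ne hq0 fun h => ?_
    rw [← h, Complex.ofReal_zero, (matCpow_ofReal_posSemidef hZ α).trace_eq_zero_iff] at hq
    have hZ0 : Z = 0 := by
      rw [← matCpow_one hZ]
      have := matCpow_mul hZ α (1 - α)
      rwa [hq, Matrix.zero_mul, add_sub_cancel, eq_comm] at this
    have h1 := matCpow_mul_matPow_conj_mul hτ hΦρ hs' (s / 2)
    rw [← hZdef, hZ0, Matrix.mul_zero, Matrix.zero_mul] at h1
    have h2 := hΦt ρ
    rw [← h1, hρ.2, Matrix.trace_zero] at h2
    exact zero_ne_one h2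
  have hppos : 0 < p := by
    refine lt_of_le_of_ne hp0 fun h => ?_
    rw [← h, Real.zero_rpow (by linarith), zero_mul] at hmain
    linarith
  have hlog := Real.log_le_log hqpos hmain
  rw [Real.log_mul (Real.rpow_pos_of_pos hppos _).ne'
    (Real.rpow_pos_of_pos (mul_pos hc hqpos) _).ne', Real.log_rpow hppos,
    Real.log_rpow (mul_pos hc hqpos), Real.log_mul hc.ne' hqpos.ne', Real.log_rpow two_pos] at hlog
  have hlog2 : 0 < Real.log 2 := Real.log_pos one_lt_two
  have hαs' : α * s = α - 1 := by exact_mod_cast hαs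
  have hfin : Real.log q ≤ Real.log p + (α - 1) * (l * Real.log 2) := by
    have := mul_le_mul_of_nonneg_left hlog hα0.le
    have e : α * ((1 - s) * Real.log p + s * (l * Real.log 2 + Real.log q)) =
        Real.log p + (α - 1) * (l * Real.log 2) + (α - 1) * Real.log q := by
      linear_combination (l * Real.log 2 + Real.log q - Real.log p) * hαs'
    rw [e] at this
    linarith
  rw [← EReal.coe_add, EReal.coe_le_coe_iff]
  have h1 : 0 < α - 1 := by linarith
  have e : (α - 1)⁻¹ * Real.logb 2 p + l =
      (α - 1)⁻¹ * ((Real.log p + (α - 1) * (l * Real.log 2)) / Real.log 2) := by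
    rw [Real.logb]; field_simp
  rw [e, Real.logb]
  gcongr

end SandwichedRenyi

section RelativeEntropy

open scoped Matrix.Norms.L2Operator

variable {ι κ : Type} [Fintype ι] [DecidableEq ι] [Fintype κ] [DecidableEq κ]
  {Φ : Matrix ι ι ℂ →ₗ[ℂ] Matrix κ κ ℂ} {ρ σ : Matrix ι ι ℂ} {τ : Matrix κ κ ℂ}

theorem TwoPositive.trace_map_mul_suppProj (hΦ : TwoPositive Φ)
    (hΦt : ∀ Y, (Φ Y).trace = Y.trace) (hρ : ρ.PosSemidef) (Y : Matrix ι ι ℂ) :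
    (Φ (Y * ρ) * matCpow (Φ ρ) 0).trace = (Y * ρ).trace := by
  rw [mul_matCpow_zero (hΦ.map_posSemidef hρ) (hΦ.suppLE_map_mul hρ Y), hΦt]

theorem TwoPositive.trace_map_mul_suppProj' (hΦ : TwoPositive Φ)
    (hΦt : ∀ Y, (Φ Y).trace = Y.trace) (hρ : ρ.PosSemidef) {Y : Matrix ι ι ℂ}
    (hY : Y.IsHermitian) :
    (Φ (ρ * Y) * matCpow (Φ ρ) 0).trace = (ρ * Y).trace := by
  have h := congrArg star (hΦ.trace_map_mul_suppProj hΦt hρ Y)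
  rw [← Matrix.trace_conjTranspose, ← Matrix.trace_conjTranspose, Matrix.conjTranspose_mul,
    Matrix.conjTranspose_mul, ← hΦ.map_conjTranspose, Matrix.conjTranspose_mul, hρ.1.eq, hY.eq,
    matCpow_conjTranspose (hΦ.map_posSemidef hρ), star_zero, Matrix.trace_mul_comm] at h
  exact h

theorem hasDerivAt_interpFun_zero (hΦ : TwoPositive Φ)
    (hΦt : ∀ Y, (Φ Y).trace = Y.trace) (hρ : ρ.PosSemidef) (hσ : σ.PosSemidef)
    (hτ : τ.PosSemidef) (hs : suppLE ρ σ) (hs' : suppLE (Φ ρ) τ) :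
    HasDerivAt (interpFun Φ σ ρ τ (Φ ρ) 1)
      ((Φ ρ * (matLn (Φ ρ) - matLn τ)).trace - (ρ * (matLn ρ - matLn σ)).trace) 0 := by
  have hΦρ := hΦ.map_posSemidef hρ
  have dS : HasDerivAt (fun z : ℂ => matCpow σ (z / 2)) ((1 / 2 : ℂ) • matLn σ) 0 := by
    have := hasDerivAt_matCpow_comp hσ ((hasDerivAt_id (0 : ℂ)).div_const 2)
    simpa [matCpow_zero_mul_matLn hσ] using this
  have dR : HasDerivAt (fun z : ℂ => matCpow ρ (((1 : ℝ) : ℂ) * (1 - z))) (-(ρ * matLn ρ)) 0 := by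
    have := hasDerivAt_matCpow_comp hρ
      (((hasDerivAt_id (0 : ℂ)).const_sub 1).const_mul ((1 : ℝ) : ℂ))
    simpa [matCpow_one hρ] using this
  have dT : HasDerivAt (fun z : ℂ => matCpow τ (-z / 2)) ((-1 / 2 : ℂ) • matLn τ) 0 := by
    have := hasDerivAt_matCpow_comp hτ ((hasDerivAt_id (0 : ℂ)).neg.div_const 2)
    simpa [matCpow_zero_mul_matLn hτ] using this
  have dQ : HasDerivAt (fun z : ℂ => matCpow (Φ ρ) (((1 : ℝ) : ℂ) * z)) (matLn (Φ ρ)) 0 := by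
    have := hasDerivAt_matCpow_comp hΦρ ((hasDerivAt_id (0 : ℂ)).const_mul ((1 : ℝ) : ℂ))
    simpa [matCpow_zero_mul_matLn hΦρ] using this
  have d1 := Φ.toContinuousLinearMap.hasFDerivAt.comp_hasDerivAt 0 ((dS.mul dR).mul dS)
  have d2 := (dT.mul dQ).mul dT
  have d3 := (Matrix.traceLinearMap κ ℂ ℂ).toContinuousLinearMap.hasFDerivAt.comp_hasDerivAt 0
    (d1.mul d2)
  refine HasDerivAt.congr_deriv (f := interpFun Φ σ ρ τ (Φ ρ) 1) d3 ?_
  have hsP : suppLE (matCpow (Φ ρ) 0) τ := by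
    intro v hv
    have e : matCpow (Φ ρ) 0 = matCpow (Φ ρ) (-1) * Φ ρ := by
      nth_rw 3 [← matCpow_one hΦρ]
      rw [matCpow_mul hΦρ, neg_add_cancel]
    rw [e, ← Matrix.mulVec_mulVec, hs' v hv, Matrix.mulVec_zero]
  have hPH : (matCpow (Φ ρ) 0).IsHermitian := by
    rw [Matrix.IsHermitian, matCpow_conjTranspose hΦρ, star_zero]
  have a1 := matCpow_zero_mul hσ hρ.1 hs
  have a2 := mul_matCpow_zero hσ hs
  have b1 := matCpow_zero_mul hτ hΦρ.1 hs'
  have b2 := mul_matCpow_zero hτ hs'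
  have c1 := matCpow_zero_mul hτ hPH hsP
  have c2 := mul_matCpow_zero hτ hsP
  have e1 := matCpow_zero_mul hΦρ hΦρ.1 (fun v hv => hv)
  have e2 := mul_matCpow_zero hΦρ (X := Φ ρ) (fun v hv => hv)
  have f1 := hΦ.trace_map_mul_suppProj hΦt hρ (matLn σ)
  have f2 := hΦ.trace_map_mul_suppProj' hΦt hρ (matLn_isHermitian hσ)
  have f3 := hΦ.trace_map_mul_suppProj' hΦt hρ (matLn_isHermitian hρ)
  have g1 : (matCpow σ 0 * -(ρ * matLn ρ)) * matCpow σ 0 = -(ρ * matLn ρ) := by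
    rw [Matrix.mul_neg, ← Matrix.mul_assoc, a1, mul_matLn_comm hρ, Matrix.neg_mul,
      Matrix.mul_assoc, a2]
  have k1 : (Φ ρ * (matLn τ * matCpow (Φ ρ) 0)).trace = (Φ ρ * matLn τ).trace := by
    rw [← Matrix.mul_assoc, Matrix.trace_mul_comm, ← Matrix.mul_assoc, e1]
  have k2 : (Φ ρ * (matLn (Φ ρ) * matCpow τ 0)).trace = (Φ ρ * matLn (Φ ρ)).trace := by
    rw [← Matrix.mul_assoc, Matrix.trace_mul_comm, ← Matrix.mul_assoc, b1]
  have k3 : (matLn σ * ρ).trace = (ρ * matLn σ).trace := Matrix.trace_mul_comm _ _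
  have z1 : matCpow ρ (((1 : ℝ) : ℂ) * (1 - 0)) = ρ := by simp [matCpow_one hρ]
  have z2 : matCpow (Φ ρ) (((1 : ℝ) : ℂ) * 0) = matCpow (Φ ρ) 0 := by simp
  have z3 : matCpow σ ((0 : ℂ) / 2) = matCpow σ 0 := by simp
  have z4 : matCpow τ (-(0 : ℂ) / 2) = matCpow τ 0 := by simp
  simp only [Pi.mul_apply, Function.comp_apply, LinearMap.coe_toContinuousLinearMap', z1, z2, z3,
    z4, Matrix.traceLinearMap_apply]
  rw [a1, a2, c1, c2, Matrix.add_mul, g1, Matrix.smul_mul, Matrix.smul_mul, Matrix.mul_assoc _ ρ,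
    a2, Matrix.mul_smul, Matrix.add_mul, Matrix.smul_mul, Matrix.smul_mul, Matrix.mul_assoc _ _
    (matCpow τ 0), c2, Matrix.mul_smul]
  simp only [map_add, map_smul, map_neg, Matrix.add_mul, Matrix.mul_add, Matrix.smul_mul,
    Matrix.mul_smul, Matrix.neg_mul, Matrix.trace_add, Matrix.trace_smul, Matrix.trace_neg,
    f1, f2, f3, k1, k3, Matrix.mul_sub, Matrix.trace_sub, Matrix.mul_assoc]
  rw [← Matrix.mul_assoc (Φ ρ) (matCpow τ 0), b2, k2, ← Matrix.mul_assoc (Φ ρ) (matCpow (Φ ρ) 0),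
    e2]
  simp only [smul_eq_mul]
  ring

theorem relEnt_map_le (hΦ : TwoPositive Φ) (hΦt : ∀ Y, (Φ Y).trace = Y.trace)
    (hρ : IsDensity ρ) (hσ : σ.PosSemidef) (hτ : τ.PosSemidef) {l : ℝ}
    (hle : ((2 : ℝ) ^ l • τ - Φ σ).PosSemidef) :
    relEnt (Φ ρ) τ ≤ relEnt ρ σ + l := by
  unfold relEnt
  by_cases hs : suppLE ρ σ
  swap
  · rw [if_neg hs, EReal.top_add_coe]
    exact le_top
  have hs' : suppLE (Φ ρ) τ := hΦ.suppLE_map_of_le hσ hle hs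
  rw [if_pos hs, if_pos hs']
  have hΦρ := hΦ.map_posSemidef hρ.1
  have hc : (0 : ℝ) < 2 ^ l := Real.rpow_pos_of_pos two_pos l
  have hd := hasDerivAt_interpFun_zero hΦ hΦt hρ.1 hσ hτ hs hs'
  set D := (Φ ρ * (matLn (Φ ρ) - matLn τ)).trace - (ρ * (matLn ρ - matLn σ)).trace with hD
  have hF0 : interpFun Φ σ ρ τ (Φ ρ) 1 0 = 1 := by
    simp only [interpFun, zero_div, neg_zero, sub_zero, mul_zero, mul_one, Complex.ofReal_one,
      matCpow_one hρ.1]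
    rw [matCpow_zero_mul hσ hρ.1.1 hs, mul_matCpow_zero hσ hs, ← Matrix.mul_assoc,
      ← Matrix.mul_assoc, mul_matCpow_zero hτ hs',
      mul_matCpow_zero hΦρ (X := Φ ρ) (fun v hv => hv), mul_matCpow_zero hτ hs', hΦt, hρ.2]
  have hd' : HasDerivAt (fun t : ℝ => ((2 : ℝ) ^ l) ^ t - (interpFun Φ σ ρ τ (Φ ρ) 1 t).re)
      (Real.log (2 ^ l) - D.re) 0 := by
    have h1 := (hasDerivAt_id (0 : ℝ)).const_rpow hc
    have h2 : HasDerivAt (fun t : ℝ => (interpFun Φ σ ρ τ (Φ ρ) 1 t).re) D.re 0 :=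
      HasDerivAt.real_of_complex (by simpa using hd)
    refine (h1.sub h2).congr_deriv ?_
    simp
  have hnn : 0 ≤ Real.log (2 ^ l) - D.re := by
    refine ge_of_tendsto hd'.tendsto_slope_zero_right ?_
    filter_upwards [Ioo_mem_nhdsGT (zero_lt_one (α := ℝ))] with t ht
    have h := norm_interpFun_ofReal_le (a := 1) (p := 1) (q := 1) hΦ hΦt hσ hρ.1 hτ hΦρ hc.le hle
      (by rw [Complex.ofReal_one, matCpow_one hρ.1, hρ.2])
      (by rw [Complex.ofReal_one, matCpow_one hΦρ, hΦt, hρ.2])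
      ht.1.le ht.2.le
    rw [Real.one_rpow, one_mul, mul_one] at h
    have h2 := (Complex.re_le_norm _).trans h
    simp only [zero_add, Real.rpow_zero, Complex.ofReal_zero, hF0, Complex.one_re, sub_self,
      sub_zero, smul_eq_mul]
    exact mul_nonneg (inv_nonneg.2 ht.1.le) (sub_nonneg.2 h2)
  have hlog2 : 0 < Real.log 2 := Real.log_pos one_lt_two
  rw [Real.log_rpow two_pos, hD, Complex.sub_re] at hnn
  have key : ∀ {n : Type} [Fintype n] [DecidableEq n] {A B : Matrix n n ℂ}, A.PosSemidef →
      B.PosSemidef → (A * (matLog2 A - matLog2 B)).trace.re =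
        (Real.log 2)⁻¹ * (A * (matLn A - matLn B)).trace.re := by
    intro n _ _ A B hA hB
    rw [matLog2_eq_smul_matLn hA, matLog2_eq_smul_matLn hB, ← smul_sub, Matrix.mul_smul,
      Matrix.trace_smul, smul_eq_mul, ← Complex.ofReal_inv, Complex.re_ofReal_mul]
  rw [key hΦρ hτ, key hρ.1 hσ, ← EReal.coe_add, EReal.coe_le_coe_iff]
  have e : (Real.log 2)⁻¹ * (ρ * (matLn ρ - matLn σ)).trace.re + l =
      (Real.log 2)⁻¹ * ((ρ * (matLn ρ - matLn σ)).trace.re + l * Real.log 2) := by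
    field_simp
  rw [e]
  gcongr
  linarith

theorem sandRenyi_map_le (hΦ : TwoPositive Φ) (hΦt : ∀ Y, (Φ Y).trace = Y.trace)
    {α : ℝ} (hα : 1 ≤ α) (hρ : IsDensity ρ) (hσ : σ.PosSemidef) (hτ : τ.PosSemidef) {l : ℝ}
    (hle : ((2 : ℝ) ^ l • τ - Φ σ).PosSemidef) :
    sandRenyi α (Φ ρ) τ ≤ sandRenyi α ρ σ + l := by
  rcases hα.eq_or_lt with rfl | h
  · simpa [sandRenyi] using relEnt_map_le hΦ hΦt hρ hσ hτ hle
  · exact sandRenyi_map_le_of_one_lt hΦ hΦt h hρ hσ hτ hle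

end RelativeEntropy

section MaxRelativeEntropy

variable {ι κ : Type} [Fintype ι] [Fintype κ] {Φ : Matrix ι ι ℂ →ₗ[ℂ] Matrix κ κ ℂ}
  {ρ σ : Matrix ι ι ℂ} {τ : Matrix κ κ ℂ}

theorem Dmax_map_le (hΦ : TwoPositive Φ) {l : ℝ}
    (hle : ((2 : ℝ) ^ l • τ - Φ σ).PosSemidef) :
    Dmax (Φ ρ) τ ≤ Dmax ρ σ + l := by
  rw [← EReal.sub_le_iff_le_add (by simp) (by simp)]
  refine le_iInf₂ fun m hm => ?_
  rw [EReal.sub_le_iff_le_add (by simp) (by simp), ← EReal.coe_add]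
  refine iInf₂_le (m + l) ?_
  have h1 := (hΦ.map_posSemidef hm).add (hle.smul (Real.rpow_pos_of_pos two_pos m).le)
  convert h1 using 1
  rw [map_sub, LinearMap.map_smul_of_tower, smul_sub, smul_smul, Real.rpow_add two_pos]
  abel

theorem Dmax_self_le_zero (ρ : Matrix ι ι ℂ) : Dmax ρ ρ ≤ 0 :=
  iInf₂_le (0 : ℝ) (by simpa using Matrix.PosSemidef.zero)

end MaxRelativeEntropy

section Channels

variable {R ι κ : Type} [Fintype ι] [Fintype κ] {N M : Matrix ι ι ℂ → Matrix κ κ ℂ}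

/-- The amplification `id_R ⊗ N` of a channel as a linear map. -/
def IsChannel.idTensorLinear (hN : IsChannel N) (R : Type) :
    Matrix (R × ι) (R × ι) ℂ →ₗ[ℂ] Matrix (R × κ) (R × κ) ℂ where
  toFun := idTensor N
  map_add' X Y := by
    ext p q
    exact congrFun₂ (hN.linear.map_add (fun a b => X (p.1, a) (q.1, b))
      (fun a b => Y (p.1, a) (q.1, b))) p.2 q.2
  map_smul' c X := by
    ext p q
    exact congrFun₂ (hN.linear.map_smul c (fun a b => X (p.1, a) (q.1, b))) p.2 q.2

theorem IsChannel.trace_idTensor [Fintype R] (hN : IsChannel N) (X : Matrix (R × ι) (R × ι) ℂ) :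
    (idTensor N X).trace = X.trace := by
  simp only [Matrix.trace, Matrix.diag, Fintype.sum_prod_type]
  exact Finset.sum_congr rfl fun r _ => hN.tracePres (fun a b => X (r, a) (r, b))

theorem IsChannel.twoPositive_idTensorLinear (hN : IsChannel N) (R : ℕ) :
    TwoPositive (hN.idTensorLinear (Fin R)) := by
  intro A G B h
  let e : Fin (R + R) × ι → (Fin R × ι) ⊕ (Fin R × ι) := fun p =>
    (finSumFinEquiv.symm p.1).elim (fun r => Sum.inl (r, p.2)) (fun r => Sum.inr (r, p.2))
  let f : (Fin R × κ) ⊕ (Fin R × κ) → Fin (R + R) × κ :=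
    Sum.elim (fun p => (Fin.castAdd R p.1, p.2)) (fun p => (Fin.natAdd R p.1, p.2))
  convert (hN.compPos (R + R) _ (h.submatrix e)).submatrix f using 1
  ext (p | p) (q | q) <;>
    simp [idTensor, IsChannel.idTensorLinear, e, f, -Fin.natAdd_eq_addNat]

theorem IsChannel.idTensor_posSemidef (hN : IsChannel N) {R : ℕ}
    {X : Matrix (Fin R × ι) (Fin R × ι) ℂ} (hX : X.PosSemidef) : (idTensor N X).PosSemidef :=
  hN.compPos R X hX

variable [DecidableEq ι] [DecidableEq κ]

/-- A divergence that increases by at most `l` under maps `id_R ⊗ N` satisfying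
`(id_R ⊗ N) σ ≤ 2 ^ l (id_R ⊗ M) σ` has amortized channel divergence at most `D_max(N‖M)`. -/
theorem amortizedDiv_le_channelDiv_DmaxFam (D : DivFam)
    (h : ∀ (R : ℕ) (ρ σ : Matrix (Fin R × ι) (Fin R × ι) ℂ) (l : ℝ), IsDensity ρ → IsDensity σ →
      ((2 : ℝ) ^ l • idTensor M σ - idTensor N σ).PosSemidef →
      D (Fin R × κ) (idTensor N ρ) (idTensor M σ) ≤ D (Fin R × ι) ρ σ + l) :
    amortizedDiv D N M ≤ channelDiv DmaxFam N M := by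
  refine iSup_le fun R => iSup_le fun ρ => iSup_le fun σ => iSup_le fun hρ => iSup_le fun hσ => ?_
  refine (EReal.le_of_forall_lt_iff_le).1 fun z hz => ?_
  have h1 : Dmax (idTensor N σ) (idTensor M σ) < z :=
    (le_iSup_of_le R (le_iSup₂_of_le
      (f := fun ω _ => DmaxFam (Fin R × κ) (idTensor N ω) (idTensor M ω)) σ hσ le_rfl)).trans_lt hz
  obtain ⟨l, hl⟩ := iInf_lt_iff.1 h1
  obtain ⟨hle, hlz⟩ := iInf_lt_iff.1 hl
  refine (EReal.sub_le_of_le_add ?_).trans hlz.le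
  rw [add_comm]
  exact h R ρ σ l hρ hσ hle

theorem channelDiv_le_amortizedDiv (D : DivFam) (hD : DivFaithful D) :
    channelDiv D N M ≤ amortizedDiv D N M := by
  refine iSup_le fun R => iSup₂_le fun ρ hρ => ?_
  refine le_iSup_of_le R (le_iSup₂_of_le ρ ρ (le_iSup₂_of_le hρ hρ ?_))
  have := EReal.sub_le_sub (le_refl (D (Fin R × κ) (idTensor N ρ) (idTensor M ρ)))
    (hD (Fin R × ι) ρ hρ)
  rwa [sub_zero] at this

end Channels

/-- For all `α ≥ 1`, the amortized sandwiched Rényi channel divergence is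
bounded by the max-relative entropy channel divergence; in particular, amortization collapses
for the max-relative entropy. -/
theorem sandRenyi_amortized_le_Dmax_and_Dmax_collapse
    {ι κ : Type} [Fintype ι] [DecidableEq ι] [Fintype κ] [DecidableEq κ]
    (N M : Matrix ι ι ℂ → Matrix κ κ ℂ) (hN : IsChannel N) (hM : IsChannel M) :
    (∀ α : ℝ, 1 ≤ α → amortizedDiv (sandFam α) N M ≤ channelDiv DmaxFam N M) ∧
      amortizedDiv DmaxFam N M = channelDiv DmaxFam N M := by
  refine ⟨fun α hα => amortizedDiv_le_channelDiv_DmaxFam _ fun R ρ σ l hρ hσ hle => ?_,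
    le_antisymm (amortizedDiv_le_channelDiv_DmaxFam _ fun R ρ σ l hρ hσ hle => ?_)
      (channelDiv_le_amortizedDiv _ fun _ _ _ ρ _ => Dmax_self_le_zero ρ)⟩
  · exact sandRenyi_map_le (Φ := hN.idTensorLinear (Fin R)) (hN.twoPositive_idTensorLinear R)
      hN.trace_idTensor hα hρ hσ.1 (hM.idTensor_posSemidef hσ.1) hle
  · exact Dmax_map_le (Φ := hN.idTensorLinear (Fin R)) (hN.twoPositive_idTensorLinear R) hle

end
end

section
/- Weak converse in the Stein setting: let N, M : A → B be quantum channels, n ∈ ℕ, and ε ∈ [0,1). For any n-round adaptive channel discrimination protocol whose type I error probability satisfies α_n ≤ ε, the type II error probability satisfies −(1/n) log₂ β_n ≤ (1/(1−ε)) · (D^A(N‖M) + h₂(ε)/n), where D^A is the amortized channel divergence for the quantum relative entropy and h₂(ε) := −ε log₂ ε − (1−ε) log₂(1−ε) is the binary entropy. -/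
open scoped BigOperators ComplexOrder

noncomputable section

attribute [local instance] Classical.propDecidable

/-- The function `t ↦ w p log (q + t p)`, whose derivative is `w p² / (q + t p)`. -/
lemma hasDerivAt_mul_log_add_mul {w p q t : ℝ} (hp : 0 ≤ p) (hq : 0 ≤ q) (ht : 0 ≤ t)
    (hs : q = 0 → w * p = 0) :
    HasDerivAt (fun t => w * p * Real.log (q + t * p)) (w * (p ^ 2 / (q + t * p))) t := by
  rcases hq.eq_or_lt with h | h
  · have h0 := hs h.symm
    have : w * (p ^ 2 / (q + t * p)) = 0 := by
      rw [show w * (p ^ 2 / (q + t * p)) = w * p * (p / (q + t * p)) by ring, h0, zero_mul]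
    rw [this]
    simpa [h0] using hasDerivAt_const t (0 : ℝ)
  · have hpos : 0 < q + t * p := by positivity
    have h1 : HasDerivAt (fun t => q + t * p) p t := by
      simpa using ((hasDerivAt_id t).mul_const p).const_add q
    refine ((h1.log hpos.ne').const_mul (w * p)).congr_deriv ?_
    ring

lemma tendsto_mul_log_add_mul_sub {w p q : ℝ} (hp : 0 ≤ p) :
    Filter.Tendsto (fun T => w * p * Real.log (q + T * p) - w * p * Real.log T) Filter.atTop
      (nhds (w * p * Real.log p)) := by
  rcases hp.eq_or_lt with h | h
  · simp [← h]
  · have h1 : Filter.Tendsto (fun T : ℝ => q / T + p) Filter.atTop (nhds (0 + p)) :=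
      (Filter.Tendsto.const_div_atTop Filter.tendsto_id q).add_const p
    rw [zero_add] at h1
    have h2 := (h1.log h.ne').const_mul (w * p)
    refine h2.congr' ?_
    filter_upwards [Filter.eventually_gt_atTop 0, h1.eventually (lt_mem_nhds h)] with T hT hT2
    have h3 : q + T * p = T * (q / T + p) := by field_simp
    rw [h3, Real.log_mul hT.ne' hT2.ne']
    ring

/-- If the resolvent sums `∑ w p² / (q + t p)` of one weighted family are dominated by those of
another one for every `t > 0`, then so are the relative entropies. -/
lemma relEnt_sum_le_of_resolvent_sum_le {S S' : Type*} [Fintype S] [Fintype S']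
    {w p q : S → ℝ} {w' p' q' : S' → ℝ} (hw : ∀ s, 0 ≤ w s) (hp : ∀ s, 0 ≤ p s)
    (hq : ∀ s, 0 ≤ q s) (hw' : ∀ s, 0 ≤ w' s) (hp' : ∀ s, 0 ≤ p' s) (hq' : ∀ s, 0 ≤ q' s)
    (h1 : ∑ s, w s * p s = 1) (h1' : ∑ s, w' s * p' s = 1)
    (hs : ∀ s, q s = 0 → w s * p s = 0)
    (hG : ∀ t : ℝ, 0 < t → ∑ s, w' s * (p' s ^ 2 / (q' s + t * p' s)) ≤
      ∑ s, w s * (p s ^ 2 / (q s + t * p s))) :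
    (∀ s, q' s = 0 → w' s * p' s = 0) ∧
      ∑ s, w' s * p' s * (Real.log (p' s) - Real.log (q' s)) ≤
        ∑ s, w s * p s * (Real.log (p s) - Real.log (q s)) := by
  have hs' : ∀ s, q' s = 0 → w' s * p' s = 0 := by
    intro s hqs
    by_contra hne
    have hpos : 0 < w' s * p' s := lt_of_le_of_ne (mul_nonneg (hw' s) (hp' s)) (Ne.symm hne)
    set C := ∑ s, w s * (p s ^ 2 / q s) with hC
    have hC0 : 0 ≤ C := Finset.sum_nonneg fun s _ =>
      mul_nonneg (hw s) (div_nonneg (sq_nonneg _) (hq s))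
    set t := w' s * p' s / (C + 1) with ht
    have htpos : 0 < t := by positivity
    have hle : ∑ s, w s * (p s ^ 2 / (q s + t * p s)) ≤ C := by
      refine Finset.sum_le_sum fun s _ => ?_
      rcases (hq s).eq_or_lt with h | h
      · have h0 := hs s h.symm
        rw [show w s * (p s ^ 2 / (q s + t * p s)) = w s * p s * (p s / (q s + t * p s)) by ring,
          show w s * (p s ^ 2 / q s) = w s * p s * (p s / q s) by ring, h0]
        simp
      · refine mul_le_mul_of_nonneg_left ?_ (hw s)
        refine div_le_div_of_nonneg_left (sq_nonneg _) h ?_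
        nlinarith [mul_nonneg htpos.le (hp s)]
    have hge : w' s * (p' s ^ 2 / (q' s + t * p' s)) ≤
        ∑ s, w' s * (p' s ^ 2 / (q' s + t * p' s)) :=
      Finset.single_le_sum (f := fun s => w' s * (p' s ^ 2 / (q' s + t * p' s)))
        (fun s _ => mul_nonneg (hw' s) (div_nonneg (sq_nonneg _)
          (add_nonneg (hq' s) (mul_nonneg htpos.le (hp' s))))) (Finset.mem_univ s)
    have hp0 : p' s ≠ 0 := fun h => hne (by rw [h, mul_zero])
    have hw0 : w' s ≠ 0 := fun h => hne (by rw [h, zero_mul])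
    have heq : w' s * (p' s ^ 2 / (q' s + t * p' s)) = C + 1 := by
      rw [hqs, ht, zero_add]
      have : C + 1 ≠ 0 := by positivity
      field_simp
    have := hG t htpos
    linarith
  refine ⟨hs', ?_⟩
  set H : ℝ → ℝ := fun t => ∑ s, w s * p s * Real.log (q s + t * p s) -
    ∑ s, w' s * p' s * Real.log (q' s + t * p' s) with hH
  have hd : ∀ t : ℝ, 0 ≤ t → HasDerivAt H (∑ s, w s * (p s ^ 2 / (q s + t * p s)) -
      ∑ s, w' s * (p' s ^ 2 / (q' s + t * p' s))) t := fun t ht =>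
    (HasDerivAt.fun_sum fun s _ =>
      hasDerivAt_mul_log_add_mul (hp s) (hq s) ht (hs s)).sub
    (HasDerivAt.fun_sum fun s _ =>
      hasDerivAt_mul_log_add_mul (hp' s) (hq' s) ht (hs' s))
  have hmono : MonotoneOn H (Set.Ici 0) := by
    refine monotoneOn_of_deriv_nonneg (convex_Ici 0)
      (fun t ht => (hd t ht).continuousAt.continuousWithinAt) ?_ ?_
    · intro t ht
      rw [interior_Ici] at ht
      exact (hd t (le_of_lt ht)).differentiableAt.differentiableWithinAt
    · intro t ht
      rw [interior_Ici] at ht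
      rw [(hd t (le_of_lt ht)).deriv]
      exact sub_nonneg.2 (hG t ht)
  have hlim : Filter.Tendsto H Filter.atTop
      (nhds (∑ s, w s * p s * Real.log (p s) - ∑ s, w' s * p' s * Real.log (p' s))) := by
    have ha := tendsto_finsetSum (Finset.univ : Finset S) fun s _ =>
      tendsto_mul_log_add_mul_sub (w := w s) (q := q s) (hp s)
    have hb := tendsto_finsetSum (Finset.univ : Finset S') fun s _ =>
      tendsto_mul_log_add_mul_sub (w := w' s) (q := q' s) (hp' s)
    refine (ha.sub hb).congr fun T => ?_
    rw [Finset.sum_sub_distrib, Finset.sum_sub_distrib, ← Finset.sum_mul, ← Finset.sum_mul, h1,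
      h1']
    simp only [hH]
    ring
  have hfin : H 0 ≤ ∑ s, w s * p s * Real.log (p s) - ∑ s, w' s * p' s * Real.log (p' s) := by
    refine ge_of_tendsto hlim ?_
    filter_upwards [Filter.eventually_ge_atTop 0] with T hT
    exact hmono (Set.mem_Ici.2 le_rfl) hT hT
  simp only [hH, zero_mul, add_zero] at hfin
  simp only [mul_sub, Finset.sum_sub_distrib]
  linarith

section Spectral

variable {ι : Type} [Fintype ι] [DecidableEq ι]

open Matrix

lemma hermFun_eq {A : Matrix ι ι ℂ} (hA : A.IsHermitian) (f : ℝ → ℝ) :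
    hermFun f A = (hA.eigenvectorUnitary : Matrix ι ι ℂ) *
      diagonal (fun i => (f (hA.eigenvalues i) : ℂ)) *
      (hA.eigenvectorUnitary : Matrix ι ι ℂ)ᴴ := by
  rw [hermFun, dif_pos hA]; rfl

lemma eq_conj_diagonal {A : Matrix ι ι ℂ} (hA : A.IsHermitian) :
    A = (hA.eigenvectorUnitary : Matrix ι ι ℂ) *
      diagonal (fun i => (hA.eigenvalues i : ℂ)) *
      (hA.eigenvectorUnitary : Matrix ι ι ℂ)ᴴ := by
  conv_lhs => rw [hA.spectral_theorem, Unitary.conjStarAlgAut_apply]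
  rfl

lemma matLog2_eq {A : Matrix ι ι ℂ} (hA : A.IsHermitian) :
    matLog2 A = (hA.eigenvectorUnitary : Matrix ι ι ℂ) *
      diagonal (fun i => (Real.logb 2 (hA.eigenvalues i) : ℂ)) *
      (hA.eigenvectorUnitary : Matrix ι ι ℂ)ᴴ := by
  rw [matLog2, hermFun_eq hA]
  congr 3
  funext i
  split_ifs with h <;> simp [h]

lemma eigenvectorUnitary_conj_mul {A : Matrix ι ι ℂ} (hA : A.IsHermitian) :
    (hA.eigenvectorUnitary : Matrix ι ι ℂ)ᴴ * (hA.eigenvectorUnitary : Matrix ι ι ℂ) = 1 :=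
  Unitary.coe_star_mul_self hA.eigenvectorUnitary

lemma eigenvectorUnitary_mul_conj {A : Matrix ι ι ℂ} (hA : A.IsHermitian) :
    (hA.eigenvectorUnitary : Matrix ι ι ℂ) * (hA.eigenvectorUnitary : Matrix ι ι ℂ)ᴴ = 1 :=
  Unitary.coe_mul_star_self hA.eigenvectorUnitary

/-- The matrix of inner products between the eigenvectors of two Hermitian matrices. -/
def eigenOverlap {A B : Matrix ι ι ℂ} (hA : A.IsHermitian) (hB : B.IsHermitian) :
    Matrix ι ι ℂ :=
  (hA.eigenvectorUnitary : Matrix ι ι ℂ)ᴴ * (hB.eigenvectorUnitary : Matrix ι ι ℂ)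

lemma trace_conj_diagonal_mul (U V : Matrix ι ι ℂ) (a b : ι → ℝ) :
    ((U * diagonal (fun i => (a i : ℂ)) * Uᴴ) * (V * diagonal (fun i => (b i : ℂ)) * Vᴴ)).trace =
      ((∑ s : ι × ι, Complex.normSq ((Uᴴ * V) s.1 s.2) * (a s.1 * b s.2) : ℝ) : ℂ) := by
  set c := Uᴴ * V with hc
  have hcc : cᴴ = Vᴴ * U := by simp [hc]
  have h : ((U * diagonal (fun i => (a i : ℂ)) * Uᴴ) *
      (V * diagonal (fun i => (b i : ℂ)) * Vᴴ)).trace =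
      (diagonal (fun i => (a i : ℂ)) * c * (diagonal (fun i => (b i : ℂ)) * cᴴ)).trace := by
    rw [hcc, hc, Matrix.mul_assoc U, Matrix.mul_assoc U, trace_mul_comm]
    simp only [Matrix.mul_assoc]
  rw [h, Fintype.sum_prod_type]
  simp only [trace, diag_apply, mul_apply (M := diagonal _ * c), diagonal_mul,
    conjTranspose_apply, RCLike.star_def]
  push_cast
  refine Finset.sum_congr rfl fun i _ => Finset.sum_congr rfl fun j _ => ?_
  rw [Complex.normSq_eq_conj_mul_self]
  ring

/-- The quadratic form whose supremum over `Z` is the resolvent sum of `ρ` and `σ`. -/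
def resolventForm (ρ σ : Matrix ι ι ℂ) (t : ℝ) (Z : Matrix ι ι ℂ) : ℝ :=
  2 * (ρ * Z).trace.re - (Zᴴ * σ * Z).trace.re - t * (Z * ρ * Zᴴ).trace.re

lemma resolventForm_conj {U V : Matrix ι ι ℂ} (hU : Uᴴ * U = 1) (hV : Vᴴ * V = 1)
    (p q : ι → ℝ) (t : ℝ) (Y : Matrix ι ι ℂ) :
    resolventForm (U * diagonal (fun i => (p i : ℂ)) * Uᴴ) (V * diagonal (fun i => (q i : ℂ)) * Vᴴ)
      t (V * Y * Uᴴ) =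
    ∑ s : ι × ι, (2 * p s.1 * ((Uᴴ * V) s.1 s.2 * Y s.2 s.1).re -
      (q s.2 + t * p s.1) * Complex.normSq (Y s.2 s.1)) := by
  have e1 : (U * diagonal (fun i => (p i : ℂ)) * Uᴴ * (V * Y * Uᴴ)).trace =
      (diagonal (fun i => (p i : ℂ)) * (Uᴴ * V) * Y).trace := by
    rw [← Matrix.mul_assoc, trace_mul_comm]
    congr 1
    calc Uᴴ * (U * diagonal (fun i => (p i : ℂ)) * Uᴴ * (V * Y))
        = (Uᴴ * U) * diagonal (fun i => (p i : ℂ)) * (Uᴴ * V) * Y := by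
          simp only [Matrix.mul_assoc]
      _ = _ := by rw [hU, Matrix.one_mul]
  have e2 : ((V * Y * Uᴴ)ᴴ * (V * diagonal (fun i => (q i : ℂ)) * Vᴴ) * (V * Y * Uᴴ)).trace =
      (Yᴴ * (diagonal (fun i => (q i : ℂ)) * Y)).trace := by
    rw [← Matrix.mul_assoc _ (V * Y), trace_mul_comm]
    congr 1
    calc _ = (Uᴴ * U) * Yᴴ * (Vᴴ * V) * diagonal (fun i => (q i : ℂ)) * (Vᴴ * V) * Y := by
          simp only [Matrix.mul_assoc, conjTranspose_mul, conjTranspose_conjTranspose]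
      _ = _ := by simp only [hU, hV, Matrix.one_mul, Matrix.mul_one, Matrix.mul_assoc]
  have e3 : ((V * Y * Uᴴ) * (U * diagonal (fun i => (p i : ℂ)) * Uᴴ) * (V * Y * Uᴴ)ᴴ).trace =
      (Y * diagonal (fun i => (p i : ℂ)) * Yᴴ).trace := by
    have : (V * Y * Uᴴ) * (U * diagonal (fun i => (p i : ℂ)) * Uᴴ) * (V * Y * Uᴴ)ᴴ =
        V * (Y * (Uᴴ * U) * diagonal (fun i => (p i : ℂ)) * (Uᴴ * U) * Yᴴ * Vᴴ) := by
      simp only [Matrix.mul_assoc, conjTranspose_mul, conjTranspose_conjTranspose]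
    rw [this, trace_mul_comm, Matrix.mul_assoc _ Vᴴ, hV, hU]
    simp only [Matrix.mul_one]
  rw [resolventForm, e1, e2, e3, Fintype.sum_prod_type]
  simp only [Finset.sum_sub_distrib, add_mul, Finset.sum_add_distrib]
  generalize Uᴴ * V = c
  have f1 : 2 * (diagonal (fun i => (p i : ℂ)) * c * Y).trace.re =
      ∑ i, ∑ j, 2 * p i * (c i j * Y j i).re := by
    simp only [trace, diag_apply, mul_apply (N := Y), diagonal_mul, Complex.re_sum,
      Finset.mul_sum, mul_assoc, Complex.re_ofReal_mul]
  have f2 : (Yᴴ * (diagonal (fun i => (q i : ℂ)) * Y)).trace.re =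
      ∑ i, ∑ j, q j * Complex.normSq (Y j i) := by
    simp only [trace, diag_apply, mul_apply (M := Yᴴ), diagonal_mul, Complex.re_sum]
    refine Finset.sum_congr rfl fun i _ => Finset.sum_congr rfl fun j _ => ?_
    rw [conjTranspose_apply, RCLike.star_def, mul_left_comm, ← Complex.normSq_eq_conj_mul_self,
      ← Complex.ofReal_mul, Complex.ofReal_re]
  have f3 : (Y * diagonal (fun i => (p i : ℂ)) * Yᴴ).trace.re =
      ∑ i, ∑ j, p i * Complex.normSq (Y j i) := by
    rw [Finset.sum_comm]
    simp only [trace, diag_apply, mul_apply (N := Yᴴ), mul_diagonal, Complex.re_sum]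
    refine Finset.sum_congr rfl fun i _ => Finset.sum_congr rfl fun j _ => ?_
    rw [conjTranspose_apply, RCLike.star_def, mul_right_comm, Complex.mul_conj, mul_comm,
      ← Complex.ofReal_mul, Complex.ofReal_re]
  rw [f1, f2, f3, Finset.mul_sum]
  simp only [Finset.mul_sum, mul_assoc]
  ring

/-- The resolvent sum `∑ |⟨eᵢ, fⱼ⟩|² pᵢ² / (qⱼ + t pᵢ)` over the eigenbases of `ρ` and `σ`. -/
def resolventSum {ρ σ : Matrix ι ι ℂ} (hρ : ρ.IsHermitian) (hσ : σ.IsHermitian) (t : ℝ) : ℝ :=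
  ∑ s : ι × ι, Complex.normSq (eigenOverlap hρ hσ s.1 s.2) *
    (hρ.eigenvalues s.1 ^ 2 / (hσ.eigenvalues s.2 + t * hρ.eigenvalues s.1))

lemma two_mul_re_sub_le {p d : ℝ} (hp : d = 0 → p = 0) (hd : 0 ≤ d) (c y : ℂ) :
    2 * p * (c * y).re - d * Complex.normSq y ≤ Complex.normSq c * (p ^ 2 / d) := by
  rcases hd.eq_or_lt with h | h
  · simp [← h, hp h.symm]
  · rw [← mul_div_assoc, le_div_iff₀ h, Complex.normSq_apply, Complex.normSq_apply, Complex.mul_re]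
    nlinarith [sq_nonneg (d * y.re - p * c.re), sq_nonneg (d * y.im + p * c.im)]

lemma resolventForm_le {ρ σ : Matrix ι ι ℂ} (hρ : ρ.PosSemidef) (hσ : σ.PosSemidef) {t : ℝ}
    (ht : 0 < t) (Z : Matrix ι ι ℂ) :
    resolventForm ρ σ t Z ≤ resolventSum hρ.isHermitian hσ.isHermitian t := by
  set U := (hρ.isHermitian.eigenvectorUnitary : Matrix ι ι ℂ) with hUdef
  set V := (hσ.isHermitian.eigenvectorUnitary : Matrix ι ι ℂ) with hVdef
  have hZ : Z = V * (Vᴴ * Z * U) * Uᴴ := by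
    calc Z = (V * Vᴴ) * Z * (U * Uᴴ) := by
          rw [eigenvectorUnitary_mul_conj, eigenvectorUnitary_mul_conj, Matrix.one_mul,
            Matrix.mul_one]
      _ = _ := by simp only [Matrix.mul_assoc]
  have key := resolventForm_conj (eigenvectorUnitary_conj_mul hρ.isHermitian)
    (eigenvectorUnitary_conj_mul hσ.isHermitian) hρ.isHermitian.eigenvalues
    hσ.isHermitian.eigenvalues t (Vᴴ * Z * U)
  rw [← eq_conj_diagonal, ← eq_conj_diagonal, ← hZ] at key
  rw [key]
  refine Finset.sum_le_sum fun s _ => two_mul_re_sub_le (fun h => ?_) ?_ _ _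
  · have h1 := hρ.eigenvalues_nonneg s.1
    have h2 := hσ.eigenvalues_nonneg s.2
    by_contra hne
    have : 0 < t * hρ.isHermitian.eigenvalues s.1 := mul_pos ht (lt_of_le_of_ne h1 (Ne.symm hne))
    linarith
  · exact add_nonneg (hσ.eigenvalues_nonneg _) (mul_nonneg ht.le (hρ.eigenvalues_nonneg _))

lemma exists_resolventForm_eq {ρ σ : Matrix ι ι ℂ} (hρ : ρ.PosSemidef) (hσ : σ.PosSemidef)
    (t : ℝ) :
    ∃ Z, resolventForm ρ σ t Z = resolventSum hρ.isHermitian hσ.isHermitian t := by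
  set p := hρ.isHermitian.eigenvalues with hp
  set q := hσ.isHermitian.eigenvalues with hq
  set c := eigenOverlap hρ.isHermitian hσ.isHermitian with hc
  have key := resolventForm_conj (eigenvectorUnitary_conj_mul hρ.isHermitian)
    (eigenvectorUnitary_conj_mul hσ.isHermitian) p q t
    (fun j i => ((p i / (q j + t * p i) : ℝ) : ℂ) * star (c i j))
  rw [← eq_conj_diagonal, ← eq_conj_diagonal] at key
  refine ⟨_, key.trans (Finset.sum_congr rfl fun s _ => ?_)⟩
  change 2 * p s.1 * (c s.1 s.2 * (_ * star (c s.1 s.2))).re - _ * Complex.normSq (_ * _) =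
    Complex.normSq (c s.1 s.2) * (p s.1 ^ 2 / (q s.2 + t * p s.1))
  rw [mul_left_comm, RCLike.star_def, Complex.mul_conj, Complex.normSq_mul, Complex.normSq_conj,
    Complex.normSq_ofReal, ← Complex.ofReal_mul, Complex.ofReal_re]
  rcases eq_or_ne (q s.2 + t * p s.1) 0 with h | h
  · simp [h]
  · field_simp
    ring

lemma suppLE_iff {ρ σ : Matrix ι ι ℂ} (hρ : ρ.IsHermitian) (hσ : σ.IsHermitian) :
    suppLE ρ σ ↔ ∀ s : ι × ι, hσ.eigenvalues s.2 = 0 →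
      Complex.normSq (eigenOverlap hρ hσ s.1 s.2) * hρ.eigenvalues s.1 = 0 := by
  set U := (hρ.eigenvectorUnitary : Matrix ι ι ℂ) with hUdef
  set V := (hσ.eigenvectorUnitary : Matrix ι ι ℂ) with hVdef
  have hU := eigenvectorUnitary_conj_mul hρ
  have hV := eigenvectorUnitary_conj_mul hσ
  have hVV := eigenvectorUnitary_mul_conj hσ
  have hρe := eq_conj_diagonal hρ
  have hσe := eq_conj_diagonal hσ
  rw [← hUdef] at hU hρe
  rw [← hVdef] at hV hVV hσe
  set p := hρ.eigenvalues with hp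
  set q := hσ.eigenvalues with hq
  have hUρ : Uᴴ * ρ = diagonal (fun i => (p i : ℂ)) * Uᴴ := by
    conv_lhs => rw [hρe]
    rw [← Matrix.mul_assoc, ← Matrix.mul_assoc, hU, Matrix.one_mul]
  have hVσ : Vᴴ * σ = diagonal (fun i => (q i : ℂ)) * Vᴴ := by
    conv_lhs => rw [hσe]
    rw [← Matrix.mul_assoc, ← Matrix.mul_assoc, hV, Matrix.one_mul]
  have hρV : Uᴴ * ρ * V = diagonal (fun i => (p i : ℂ)) * eigenOverlap hρ hσ := by
    rw [hUρ, Matrix.mul_assoc]; rfl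
  have hσV : σ * V = V * diagonal (fun i => (q i : ℂ)) := by
    conv_lhs => rw [hσe]
    rw [Matrix.mul_assoc, hV, Matrix.mul_one]
  constructor
  · rintro h ⟨i, j⟩ hj
    have h1 : σ *ᵥ (V *ᵥ Pi.single j 1) = 0 := by
      rw [mulVec_mulVec, hσV, ← mulVec_mulVec]
      have : diagonal (fun i => (q i : ℂ)) *ᵥ Pi.single j 1 = 0 := by
        ext k
        rw [mulVec_diagonal]
        rcases eq_or_ne k j with rfl | hk
        · simp [show q k = 0 from hj]
        · simp [hk]
      rw [this, mulVec_zero]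
    have h2 : (Uᴴ * ρ * V) i j = 0 := by
      have := congrFun (congrArg (fun v => Uᴴ *ᵥ v) (h _ h1)) i
      simp only [mulVec_mulVec, mulVec_single_one, mulVec_zero] at this
      exact this
    rw [hρV, diagonal_mul] at h2
    rcases mul_eq_zero.1 h2 with h3 | h3
    · rw [Complex.ofReal_eq_zero] at h3
      rw [h3, mul_zero]
    · simp [h3]
  · intro h v hv
    have h1 : ∀ j, (q j : ℂ) * (Vᴴ *ᵥ v) j = 0 := by
      intro j
      have := congrFun (congrArg (fun v => Vᴴ *ᵥ v) hv) j
      simp only [mulVec_mulVec, hVσ, mulVec_zero] at this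
      rwa [← mulVec_mulVec, mulVec_diagonal] at this
    have h2 : Uᴴ *ᵥ (ρ *ᵥ v) = 0 := by
      have e : Uᴴ *ᵥ (ρ *ᵥ v) =
          (diagonal (fun i => (p i : ℂ)) * eigenOverlap hρ hσ) *ᵥ (Vᴴ *ᵥ v) := by
        rw [← hρV, mulVec_mulVec, mulVec_mulVec, Matrix.mul_assoc _ V, hVV, Matrix.mul_one]
      rw [e]
      ext i
      simp only [mulVec, dotProduct, diagonal_mul, Pi.zero_apply]
      refine Finset.sum_eq_zero fun j _ => ?_
      rcases eq_or_ne (q j) 0 with hj | hj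
      · rcases mul_eq_zero.1 (h (i, j) hj) with h3 | h3
        · rw [Complex.normSq_eq_zero] at h3
          simp [h3]
        · simp [show p i = 0 from h3]
      · have := (mul_eq_zero.1 (h1 j)).resolve_left (by exact_mod_cast hj)
        simp only [mulVec, dotProduct] at this
        rw [this, mul_zero]
    have h3 : U *ᵥ (Uᴴ *ᵥ (ρ *ᵥ v)) = 0 := by rw [h2, mulVec_zero]
    rwa [mulVec_mulVec, eigenvectorUnitary_mul_conj, one_mulVec] at h3

/-- The relative entropy in natural units as a sum over pairs of eigenvectors. -/
def relEntSum {ρ σ : Matrix ι ι ℂ} (hρ : ρ.IsHermitian) (hσ : σ.IsHermitian) : ℝ :=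
  ∑ s : ι × ι, Complex.normSq (eigenOverlap hρ hσ s.1 s.2) * hρ.eigenvalues s.1 *
    (Real.log (hρ.eigenvalues s.1) - Real.log (hσ.eigenvalues s.2))

lemma trace_mul_log_sub {ρ σ : Matrix ι ι ℂ} (hρ : ρ.IsHermitian) (hσ : σ.IsHermitian) :
    ((ρ * (matLog2 ρ - matLog2 σ)).trace).re = relEntSum hρ hσ / Real.log 2 := by
  have h1 : ρ * matLog2 ρ = ((hρ.eigenvectorUnitary : Matrix ι ι ℂ) *
      diagonal (fun i => ((hρ.eigenvalues i * Real.logb 2 (hρ.eigenvalues i) : ℝ) : ℂ)) *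
      (hρ.eigenvectorUnitary : Matrix ι ι ℂ)ᴴ) * ((hσ.eigenvectorUnitary : Matrix ι ι ℂ) *
      diagonal (fun _ => ((1 : ℝ) : ℂ)) * (hσ.eigenvectorUnitary : Matrix ι ι ℂ)ᴴ) := by
    rw [matLog2_eq hρ]
    simp only [Complex.ofReal_one, diagonal_one, Matrix.mul_one, eigenvectorUnitary_mul_conj]
    refine (congrArg (· * _) (eq_conj_diagonal hρ)).trans ?_
    calc _ = (hρ.eigenvectorUnitary : Matrix ι ι ℂ) *
          diagonal (fun i => (hρ.eigenvalues i : ℂ)) *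
          ((hρ.eigenvectorUnitary : Matrix ι ι ℂ)ᴴ * (hρ.eigenvectorUnitary : Matrix ι ι ℂ)) *
          diagonal (fun i => (Real.logb 2 (hρ.eigenvalues i) : ℂ)) *
          (hρ.eigenvectorUnitary : Matrix ι ι ℂ)ᴴ := by simp only [Matrix.mul_assoc]
      _ = _ := by
        rw [eigenvectorUnitary_conj_mul, Matrix.mul_one, Matrix.mul_assoc (hρ.eigenvectorUnitary : Matrix ι ι ℂ) (diagonal _),
          diagonal_mul_diagonal]
        simp only [Complex.ofReal_mul]
  have h2 : ρ * matLog2 σ = ((hρ.eigenvectorUnitary : Matrix ι ι ℂ) *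
      diagonal (fun i => (hρ.eigenvalues i : ℂ)) *
      (hρ.eigenvectorUnitary : Matrix ι ι ℂ)ᴴ) * ((hσ.eigenvectorUnitary : Matrix ι ι ℂ) *
      diagonal (fun i => (Real.logb 2 (hσ.eigenvalues i) : ℂ)) *
      (hσ.eigenvectorUnitary : Matrix ι ι ℂ)ᴴ) := by
    rw [matLog2_eq hσ]
    exact congrArg (· * _) (eq_conj_diagonal hρ)
  rw [Matrix.mul_sub, trace_sub, h1, h2, trace_conj_diagonal_mul, trace_conj_diagonal_mul,
    ← Complex.ofReal_sub, Complex.ofReal_re, ← Finset.sum_sub_distrib, relEntSum, Finset.sum_div]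
  refine Finset.sum_congr rfl fun s _ => ?_
  simp only [Real.logb, eigenOverlap]
  ring

lemma sum_normSq_mul_eigenvalues {ρ σ : Matrix ι ι ℂ} (hρ : ρ.IsHermitian) (hσ : σ.IsHermitian)
    (h : ρ.trace = 1) :
    ∑ s : ι × ι, Complex.normSq (eigenOverlap hρ hσ s.1 s.2) * hρ.eigenvalues s.1 = 1 := by
  have key := trace_conj_diagonal_mul (hρ.eigenvectorUnitary : Matrix ι ι ℂ)
    (hσ.eigenvectorUnitary : Matrix ι ι ℂ) hρ.eigenvalues (fun _ => 1)
  rw [← eq_conj_diagonal] at key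
  simp only [Complex.ofReal_one, diagonal_one, eigenvectorUnitary_mul_conj, h, mul_one] at key
  exact_mod_cast key.symm

lemma relEnt_eq {ρ σ : Matrix ι ι ℂ} (hρ : ρ.IsHermitian) (hσ : σ.IsHermitian)
    (h : suppLE ρ σ) : relEnt ρ σ = ((relEntSum hρ hσ / Real.log 2 : ℝ) : EReal) := by
  rw [relEnt, if_pos h, trace_mul_log_sub hρ hσ]

end Spectral

section ChannelBasics

variable {ι κ : Type} [Fintype ι] [Fintype κ]

open Matrix

lemma IsChannel.posSemidef {Φ : Matrix ι ι ℂ → Matrix κ κ ℂ} (hΦ : IsChannel Φ)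
    {ρ : Matrix ι ι ℂ} (hρ : ρ.PosSemidef) : (Φ ρ).PosSemidef := by
  have h := (hΦ.compPos 1 _ (hρ.submatrix Prod.snd)).submatrix (fun a : κ => ((0 : Fin 1), a))
  exact h

lemma IsChannel.isDensity {Φ : Matrix ι ι ℂ → Matrix κ κ ℂ} (hΦ : IsChannel Φ)
    {ρ : Matrix ι ι ℂ} (hρ : IsDensity ρ) : IsDensity (Φ ρ) :=
  ⟨hΦ.posSemidef hρ.1, (hΦ.tracePres ρ).trans hρ.2⟩

lemma IsChannel.isDensity_idTensor {Φ : Matrix ι ι ℂ → Matrix κ κ ℂ} (hΦ : IsChannel Φ) {k : ℕ}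
    {ρ : Matrix (Fin k × ι) (Fin k × ι) ℂ} (hρ : IsDensity ρ) : IsDensity (idTensor Φ ρ) := by
  refine ⟨hΦ.compPos k ρ hρ.1, ?_⟩
  rw [← hρ.2]
  simp only [trace, diag_apply, Fintype.sum_prod_type]
  refine Finset.sum_congr rfl fun r _ => ?_
  exact hΦ.tracePres fun a b => ρ (r, a) (r, b)

end ChannelBasics

section Channel

variable {ι κ : Type} [Fintype ι] [DecidableEq ι] [Fintype κ] [DecidableEq κ]

open Matrix

lemma trace_mul_re_nonneg {A B : Matrix ι ι ℂ} (hA : A.PosSemidef) (hB : B.PosSemidef) :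
    0 ≤ (A * B).trace.re := by
  rw [eq_conj_diagonal hA.isHermitian, eq_conj_diagonal hB.isHermitian, trace_conj_diagonal_mul,
    Complex.ofReal_re]
  exact Finset.sum_nonneg fun s _ => mul_nonneg (Complex.normSq_nonneg _)
    (mul_nonneg (hA.eigenvalues_nonneg _) (hB.eigenvalues_nonneg _))

/-- Every linear map has an adjoint for the trace pairing. -/
lemma exists_trace_adjoint {Φ : Matrix ι ι ℂ → Matrix κ κ ℂ} (hΦ : IsLinearMap ℂ Φ)
    (Y : Matrix κ κ ℂ) : ∃ Z : Matrix ι ι ℂ, ∀ X, (Φ X * Y).trace = (X * Z).trace := by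
  refine ⟨Matrix.of fun b a => (Φ (single a b 1) * Y).trace, fun X => ?_⟩
  let f : Matrix ι ι ℂ →ₗ[ℂ] ℂ :=
    (traceLinearMap κ ℂ ℂ).comp ((LinearMap.mulRight ℂ Y).comp (hΦ.mk' Φ))
  have hf : ∀ X, f X = (Φ X * Y).trace := fun _ => rfl
  have hs : ∀ a b, single a b (X a b) = X a b • single a b (1 : ℂ) := fun a b => by
    rw [smul_single, smul_eq_mul, mul_one]
  rw [← hf]
  conv_lhs => rw [matrix_eq_sum_single X]
  simp only [map_sum, hs, map_smul, smul_eq_mul]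
  simp only [hf, trace, diag_apply, Matrix.mul_apply (M := X), of_apply]

/-- The Kadison–Schwarz inequality of a channel, in trace form. -/
lemma IsChannel.schwarz {Φ : Matrix ι ι ℂ → Matrix κ κ ℂ} (hΦ : IsChannel Φ) {σ : Matrix ι ι ℂ}
    (hσ : σ.PosSemidef) (W : Matrix ι ι ℂ) (V : Matrix κ κ ℂ) :
    Φ (σ * W) = (Φ (Wᴴ * σ))ᴴ ∧
      2 * (Φ (Wᴴ * σ) * V).trace.re ≤ (Vᴴ * Φ σ * V).trace.re + (Wᴴ * σ * W).trace.re := by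
  let B : Matrix ι (Fin 2 × ι) ℂ := fun a p => if p.1 = 0 then (1 : Matrix ι ι ℂ) a p.2 else W a p.2
  let C : Matrix (Fin 2 × κ) κ ℂ := fun p b => if p.1 = 0 then V p.2 b else -(1 : Matrix κ κ ℂ) p.2 b
  have hX := hΦ.compPos 2 _ (hσ.conjTranspose_mul_mul_same B)
  have B0 : ∀ a i, B a (0, i) = (1 : Matrix ι ι ℂ) a i := fun _ _ => rfl
  have B1 : ∀ a i, B a (1, i) = W a i := fun _ _ => rfl
  have C0 : ∀ b i, C (0, i) b = V i b := fun _ _ => rfl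
  have C1 : ∀ b i, C (1, i) b = -(1 : Matrix κ κ ℂ) i b := fun _ _ => rfl
  have b00 : (fun a b => (Bᴴ * σ * B) (0, a) (0, b)) = σ := by
    ext a b
    simp [Matrix.mul_apply, B0, one_apply]
  have b01 : (fun a b => (Bᴴ * σ * B) (0, a) (1, b)) = σ * W := by
    ext a b
    simp [Matrix.mul_apply, B0, B1, one_apply]
  have b10 : (fun a b => (Bᴴ * σ * B) (1, a) (0, b)) = Wᴴ * σ := by
    ext a b
    simp [Matrix.mul_apply, B0, B1, one_apply]
  have b11 : (fun a b => (Bᴴ * σ * B) (1, a) (1, b)) = Wᴴ * σ * W := by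
    ext a b
    simp [Matrix.mul_apply, B1]
  have hherm : Φ (σ * W) = (Φ (Wᴴ * σ))ᴴ := by
    ext a b
    have := congrFun (congrFun hX.isHermitian (0, a)) (1, b)
    simp only [conjTranspose_apply, idTensor, b01, b10] at this
    exact this.symm
  refine ⟨hherm, ?_⟩
  have hC := (hX.conjTranspose_mul_mul_same C).trace_nonneg
  have e : Cᴴ * idTensor Φ (Bᴴ * σ * B) * C =
      Vᴴ * Φ σ * V - Φ (Wᴴ * σ) * V - Vᴴ * Φ (σ * W) + Φ (Wᴴ * σ * W) := by
    ext a b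
    rw [Matrix.mul_apply]
    simp only [Matrix.mul_apply (M := Cᴴ), Fintype.sum_prod_type, Fin.sum_univ_two, idTensor,
      b00, b01, b10, b11, conjTranspose_apply, C0, C1]
    simp [Matrix.mul_apply (N := V), Matrix.mul_apply (M := Vᴴ), one_apply, add_mul,
      Finset.sum_add_distrib]
    ring
  rw [e, trace_add, trace_sub, trace_sub, hΦ.tracePres (Wᴴ * σ * W), hherm,
    ← conjTranspose_mul, trace_conjTranspose] at hC
  have := (Complex.nonneg_iff.1 hC).1
  simp only [Complex.add_re, Complex.sub_re, RCLike.star_def, Complex.conj_re] at this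
  linarith

lemma IsChannel.resolventSum_le {Φ : Matrix ι ι ℂ → Matrix κ κ ℂ} (hΦ : IsChannel Φ)
    {ρ σ : Matrix ι ι ℂ} (hρ : ρ.PosSemidef) (hσ : σ.PosSemidef) {t : ℝ} (ht : 0 < t) :
    resolventSum (hΦ.posSemidef hρ).isHermitian (hΦ.posSemidef hσ).isHermitian t ≤
      resolventSum hρ.isHermitian hσ.isHermitian t := by
  obtain ⟨Y, hY⟩ := exists_resolventForm_eq (hΦ.posSemidef hρ) (hΦ.posSemidef hσ) t
  obtain ⟨Z, hZ⟩ := exists_trace_adjoint hΦ.linear Y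
  rw [← hY]
  refine le_trans ?_ (resolventForm_le hρ hσ ht Z)
  have h1 := (hΦ.schwarz hσ Z Y).2
  obtain ⟨h2, h3⟩ := hΦ.schwarz hρ Zᴴ Yᴴ
  rw [conjTranspose_conjTranspose] at h2 h3
  have h4 : (Φ (Z * ρ) * Yᴴ).trace.re = (Z * ρ * Zᴴ).trace.re := by
    have : (Φ (Z * ρ) * Yᴴ).trace = star (Φ (ρ * Zᴴ) * Y).trace := by
      rw [← trace_conjTranspose, conjTranspose_mul, h2, conjTranspose_conjTranspose,
        trace_mul_comm]
    rw [this, hZ, RCLike.star_def, Complex.conj_re, Matrix.mul_assoc, trace_mul_comm,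
      Matrix.mul_assoc, trace_mul_comm, trace_mul_cycle]
  rw [h4, conjTranspose_conjTranspose] at h3
  rw [hZ] at h1
  simp only [resolventForm, hZ]
  nlinarith

/-- The data processing inequality for the quantum relative entropy. -/
lemma IsChannel.relEnt_le {Φ : Matrix ι ι ℂ → Matrix κ κ ℂ} (hΦ : IsChannel Φ)
    {ρ σ : Matrix ι ι ℂ} (hρ : IsDensity ρ) (hσ : IsDensity σ) :
    relEnt (Φ ρ) (Φ σ) ≤ relEnt ρ σ := by
  by_cases hs : suppLE ρ σ
  · have hρ' := hΦ.isDensity hρ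
    have hσ' := hΦ.isDensity hσ
    obtain ⟨h1, h2⟩ := relEnt_sum_le_of_resolvent_sum_le
      (w := fun s : ι × ι =>
        Complex.normSq (eigenOverlap hρ.1.isHermitian hσ.1.isHermitian s.1 s.2))
      (p := fun s => hρ.1.isHermitian.eigenvalues s.1)
      (q := fun s => hσ.1.isHermitian.eigenvalues s.2)
      (w' := fun s : κ × κ =>
        Complex.normSq (eigenOverlap hρ'.1.isHermitian hσ'.1.isHermitian s.1 s.2))
      (p' := fun s => hρ'.1.isHermitian.eigenvalues s.1)
      (q' := fun s => hσ'.1.isHermitian.eigenvalues s.2)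
      (fun _ => Complex.normSq_nonneg _)
      (fun s => hρ.1.eigenvalues_nonneg s.1) (fun s => hσ.1.eigenvalues_nonneg s.2)
      (fun _ => Complex.normSq_nonneg _)
      (fun s => hρ'.1.eigenvalues_nonneg s.1) (fun s => hσ'.1.eigenvalues_nonneg s.2)
      (sum_normSq_mul_eigenvalues _ _ hρ.2) (sum_normSq_mul_eigenvalues _ _ hρ'.2)
      ((suppLE_iff _ _).1 hs) (fun t ht => hΦ.resolventSum_le hρ.1 hσ.1 ht)
    rw [relEnt_eq hρ.1.isHermitian hσ.1.isHermitian hs, relEnt_eq hρ'.1.isHermitian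
      hσ'.1.isHermitian ((suppLE_iff _ _).2 h1), EReal.coe_le_coe_iff]
    exact div_le_div_of_nonneg_right h2 (Real.log_nonneg one_le_two)
  · rw [relEnt, relEnt, if_neg hs]
    exact le_top

lemma trace_conj_two_outcome_le {Q σ : Matrix ι ι ℂ} (hQ : Q.PosSemidef)
    (hQ1 : (1 - Q).PosSemidef) (hσ : IsDensity σ) (a b : ℝ) :
    (((a : ℂ) • Q + (b : ℂ) • (1 - Q)) * σ * ((a : ℂ) • Q + (b : ℂ) • (1 - Q))).trace.re ≤
      a ^ 2 * (Q * σ).trace.re + b ^ 2 * (1 - (Q * σ).trace.re) := by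
  have hpsd : (Q - Q * Q).PosSemidef := by
    have h1 := (hQ1.conjTranspose_mul_mul_same Q).add (hQ.conjTranspose_mul_mul_same (1 - Q))
    have e : Qᴴ * (1 - Q) * Q + (1 - Q)ᴴ * Q * (1 - Q) = Q - Q * Q := by
      rw [hQ.isHermitian.eq, hQ1.isHermitian.eq]
      noncomm_ring
    rwa [e] at h1
  have h := trace_mul_re_nonneg hpsd hσ.1
  have e : (((a : ℂ) • Q + (b : ℂ) • (1 - Q)) * σ * ((a : ℂ) • Q + (b : ℂ) • (1 - Q))).trace =
      (a : ℂ) ^ 2 * (Q * σ).trace + (b : ℂ) ^ 2 * (1 - (Q * σ).trace) -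
        ((a : ℂ) - b) ^ 2 * ((Q - Q * Q) * σ).trace := by
    rw [trace_mul_comm, ← Matrix.mul_assoc, ← hσ.2]
    have : ((a : ℂ) • Q + (b : ℂ) • (1 - Q)) * ((a : ℂ) • Q + (b : ℂ) • (1 - Q)) * σ =
        (a : ℂ) ^ 2 • (Q * σ) + (b : ℂ) ^ 2 • (σ - Q * σ) -
          ((a : ℂ) - b) ^ 2 • ((Q - Q * Q) * σ) := by
      simp only [add_mul, mul_add, sub_mul, mul_sub, smul_mul_assoc, mul_smul_comm, one_mul,
        mul_one]
      module
    rw [this]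
    simp only [trace_add, trace_sub, trace_smul, smul_eq_mul]
  rw [e]
  norm_cast
  simp only [Complex.add_re, Complex.sub_re, Complex.re_ofReal_mul, Complex.one_re]
  nlinarith [mul_nonneg (sq_nonneg (a - b)) h]

lemma trace_one_sub_mul {Q σ : Matrix ι ι ℂ} (hσ : IsDensity σ) :
    ((1 - Q) * σ).trace.re = 1 - (Q * σ).trace.re := by
  rw [sub_mul, one_mul, trace_sub, hσ.2, Complex.sub_re, Complex.one_re]

/-- Data processing under a two-outcome measurement. -/
lemma binary_relEnt_le {Q ρ σ : Matrix ι ι ℂ} (hQ : Q.PosSemidef) (hQ1 : (1 - Q).PosSemidef)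
    (hρ : IsDensity ρ) (hσ : IsDensity σ) (hs : suppLE ρ σ) {p q : ℝ}
    (hp : (Q * ρ).trace.re = p) (hq : (Q * σ).trace.re = q) :
    (q = 0 → p = 0) ∧
      p * (Real.log p - Real.log q) + (1 - p) * (Real.log (1 - p) - Real.log (1 - q)) ≤
        relEntSum hρ.1.isHermitian hσ.1.isHermitian := by
  have hp0 : 0 ≤ p := hp ▸ trace_mul_re_nonneg hQ hρ.1
  have hq0 : 0 ≤ q := hq ▸ trace_mul_re_nonneg hQ hσ.1
  have hp1 : 0 ≤ 1 - p := by
    rw [← hp, ← trace_one_sub_mul hρ]; exact trace_mul_re_nonneg hQ1 hρ.1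
  have hq1 : 0 ≤ 1 - q := by
    rw [← hq, ← trace_one_sub_mul hσ]; exact trace_mul_re_nonneg hQ1 hσ.1
  have key := relEnt_sum_le_of_resolvent_sum_le
      (w := fun s : ι × ι =>
        Complex.normSq (eigenOverlap hρ.1.isHermitian hσ.1.isHermitian s.1 s.2))
      (p := fun s => hρ.1.isHermitian.eigenvalues s.1)
      (q := fun s => hσ.1.isHermitian.eigenvalues s.2) (w' := fun _ : Bool => 1)
      (p' := fun s => if s then p else 1 - p) (q' := fun s => if s then q else 1 - q)
      (fun _ => Complex.normSq_nonneg _)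
      (fun s => hρ.1.eigenvalues_nonneg s.1) (fun s => hσ.1.eigenvalues_nonneg s.2)
      (fun _ => zero_le_one) (fun s => by cases s <;> simp [hp0, sub_nonneg.1 hp1])
      (fun s => by cases s <;> simp [hq0, sub_nonneg.1 hq1])
      (sum_normSq_mul_eigenvalues _ _ hρ.2) (by simp)
      ((suppLE_iff _ _).1 hs) (fun t ht => by
        have hopt : ∀ x y : ℝ, 0 ≤ x → 0 ≤ y → x ^ 2 / (y + t * x) =
            2 * (x / (y + t * x)) * x - (y + t * x) * (x / (y + t * x)) ^ 2 := by
          intro x y hx hy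
          rcases eq_or_ne (y + t * x) 0 with h | h
          · simp [h]
          · field_simp
            ring
        have hle := resolventForm_le hρ.1 hσ.1 ht
          (((p / (q + t * p) : ℝ) : ℂ) • Q +
            (((1 - p) / (1 - q + t * (1 - p)) : ℝ) : ℂ) • (1 - Q))
        refine le_trans ?_ hle
        simp only [Fintype.sum_bool, if_true, one_mul, Bool.false_eq_true, if_false]
        rw [hopt p q hp0 hq0, hopt (1 - p) (1 - q) hp1 hq1]
        generalize p / (q + t * p) = a
        generalize (1 - p) / (1 - q + t * (1 - p)) = b
        have hherm : ((a : ℂ) • Q + (b : ℂ) • (1 - Q))ᴴ = (a : ℂ) • Q + (b : ℂ) • (1 - Q) := by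
          simp only [conjTranspose_add, conjTranspose_smul, hQ.isHermitian.eq,
            hQ1.isHermitian.eq, RCLike.star_def, Complex.conj_ofReal]
        have hσle := trace_conj_two_outcome_le hQ hQ1 hσ a b
        have hρle := mul_le_mul_of_nonneg_left (trace_conj_two_outcome_le hQ hQ1 hρ a b) ht.le
        have hlin : (ρ * ((a : ℂ) • Q + (b : ℂ) • (1 - Q))).trace.re = a * p + b * (1 - p) := by
          rw [trace_mul_comm, add_mul, smul_mul_assoc, smul_mul_assoc, trace_add, trace_smul,
            trace_smul, smul_eq_mul, smul_eq_mul, Complex.add_re, Complex.re_ofReal_mul,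
            Complex.re_ofReal_mul, trace_one_sub_mul hρ, hp]
        rw [resolventForm, hherm, hlin]
        rw [hq] at hσle
        rw [hp] at hρle
        nlinarith)
  refine ⟨fun h => ?_, ?_⟩
  · simpa using key.1 true (by simpa using h)
  · simpa [Fintype.sum_bool, relEntSum] using key.2

end Channel

section Adaptive

variable {ι κ : Type} [Fintype ι] [DecidableEq ι] [Fintype κ] [DecidableEq κ]

lemma relEnt_self (ρ : Matrix ι ι ℂ) : relEnt ρ ρ = 0 := by
  rw [relEnt, if_pos (show suppLE ρ ρ from fun _ h => h), sub_self, mul_zero, Matrix.trace_zero, Complex.zero_re,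
    EReal.coe_zero]

lemma relEnt_ne_bot (ρ σ : Matrix ι ι ℂ) : relEnt ρ σ ≠ ⊥ := by
  rw [relEnt]
  split_ifs
  · exact EReal.coe_ne_bot _
  · exact top_ne_bot

lemma relEnt_sub_le_amortizedDiv (N M : Matrix ι ι ℂ → Matrix κ κ ℂ) {R : ℕ}
    {ρ σ : Matrix (Fin R × ι) (Fin R × ι) ℂ} (hρ : IsDensity ρ) (hσ : IsDensity σ) :
    relEnt (idTensor N ρ) (idTensor M σ) - relEnt ρ σ ≤ amortizedDiv relEntFam N M :=
  le_iSup_of_le R <| le_iSup_of_le ρ <| le_iSup_of_le σ <| le_iSup_of_le hρ <|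
    le_iSup_of_le hσ le_rfl

lemma amortizedDiv_ne_bot (N M : Matrix ι ι ℂ → Matrix κ κ ℂ) {R : ℕ}
    {ρ : Matrix (Fin R × ι) (Fin R × ι) ℂ} (hρ : IsDensity ρ) :
    amortizedDiv relEntFam N M ≠ ⊥ := by
  have h := relEnt_sub_le_amortizedDiv N M hρ hρ
  rw [relEnt_self, sub_zero] at h
  exact ne_bot_of_le_ne_bot (relEnt_ne_bot _ _) h

lemma relEnt_idTensor_le {N M : Matrix ι ι ℂ → Matrix κ κ ℂ} {a x : ℝ}
    (ha : amortizedDiv relEntFam N M = a) {R : ℕ} {ρ σ : Matrix (Fin R × ι) (Fin R × ι) ℂ}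
    (hρ : IsDensity ρ) (hσ : IsDensity σ) (h : relEnt ρ σ ≤ x) :
    relEnt (idTensor N ρ) (idTensor M σ) ≤ ((a + x : ℝ) : EReal) := by
  have h1 := relEnt_sub_le_amortizedDiv N M hρ hσ
  rw [ha, EReal.sub_le_iff_le_add (Or.inl (relEnt_ne_bot _ _))
    (Or.inl (ne_top_of_le_ne_top (EReal.coe_ne_top x) h))] at h1
  rw [EReal.coe_add]
  exact h1.trans (add_le_add_right h _)

namespace Protocol

variable {m : ℕ} (P : Protocol ι κ m)

lemma isDensity_evolve {Ch : Matrix ι ι ℂ → Matrix κ κ ℂ} (hCh : IsChannel Ch) {i : ℕ}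
    (hi : i ≤ m) : IsDensity (P.evolve Ch i) := by
  induction i with
  | zero => exact P.init_density
  | succ i ih =>
    exact (P.adapt_channel i hi).isDensity (hCh.isDensity_idTensor (ih (Nat.le_of_succ_le hi)))

lemma relEnt_evolve_le {N M : Matrix ι ι ℂ → Matrix κ κ ℂ} (hN : IsChannel N) (hM : IsChannel M)
    {a : ℝ} (ha : amortizedDiv relEntFam N M = a) {i : ℕ} (hi : i ≤ m) :
    relEnt (P.evolve N i) (P.evolve M i) ≤ ((i * a : ℝ) : EReal) := by
  induction i with
  | zero => simp [evolve, relEnt_self]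
  | succ i ih =>
    have hi' := Nat.le_of_succ_le hi
    have hρ := P.isDensity_evolve hN hi'
    have hσ := P.isDensity_evolve hM hi'
    refine ((P.adapt_channel i hi).relEnt_le (hN.isDensity_idTensor hρ)
      (hM.isDensity_idTensor hσ)).trans ((relEnt_idTensor_le ha hρ hσ (ih hi')).trans_eq ?_)
    rw [Nat.cast_succ, add_one_mul, add_comm]

lemma isDensity_final {Ch : Matrix ι ι ℂ → Matrix κ κ ℂ} (hCh : IsChannel Ch) :
    IsDensity (P.final Ch) :=
  hCh.isDensity_idTensor (P.isDensity_evolve hCh le_rfl)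

/-- The meta-converse: each channel use increases the relative entropy by at most the amortized
divergence. -/
lemma relEnt_final_le {N M : Matrix ι ι ℂ → Matrix κ κ ℂ} (hN : IsChannel N) (hM : IsChannel M)
    {a : ℝ} (ha : amortizedDiv relEntFam N M = a) :
    relEnt (P.final N) (P.final M) ≤ (((m + 1) * a : ℝ) : EReal) := by
  refine (relEnt_idTensor_le ha (P.isDensity_evolve hN le_rfl) (P.isDensity_evolve hM le_rfl)
    (P.relEnt_evolve_le hN hM ha le_rfl)).trans_eq ?_
  rw [add_one_mul, add_comm]

end Protocol

/-- The weak converse for a single pair of states: rescaling the test makes its type I error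
exactly `ε`. -/
lemma neg_log_le_of_relEnt_le {Q ρ σ : Matrix ι ι ℂ} (hQ : Q.PosSemidef)
    (hQ1 : (1 - Q).PosSemidef) (hρ : IsDensity ρ) (hσ : IsDensity σ) {D ε : ℝ}
    (hD : relEnt ρ σ ≤ D) (hε0 : 0 ≤ ε) (hε1 : ε < 1) (hα : ((1 - Q) * ρ).trace.re ≤ ε) :
    0 < (Q * σ).trace.re ∧ (1 - ε) * -Real.logb 2 (Q * σ).trace.re ≤ D + h2 ε := by
  have hs : suppLE ρ σ := by
    by_contra h
    rw [relEnt, if_neg h] at hD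
    exact EReal.coe_ne_top D (top_le_iff.1 hD)
  have hlog2 : 0 < Real.log 2 := Real.log_pos one_lt_two
  rw [relEnt_eq hρ.1.isHermitian hσ.1.isHermitian hs, EReal.coe_le_coe_iff,
    div_le_iff₀ hlog2] at hD
  rw [trace_one_sub_mul hρ] at hα
  set p := (Q * ρ).trace.re with hp
  set q := (Q * σ).trace.re with hq
  have hp0 : 0 < p := by linarith
  set c := (1 - ε) / p with hc
  have hc0 : 0 < c := div_pos (by linarith) hp0
  have hc1 : c ≤ 1 := (div_le_one hp0).2 (by linarith)
  have hcp : c * p = 1 - ε := div_mul_cancel₀ _ hp0.ne'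
  have hcQ : ((c : ℂ) • Q).PosSemidef := hQ.smul (by exact_mod_cast hc0.le)
  have hcQ1 : (1 - (c : ℂ) • Q).PosSemidef := by
    have h1 : (((1 - c : ℝ) : ℂ) • (1 : Matrix ι ι ℂ)).PosSemidef :=
      Matrix.PosSemidef.one.smul (by exact_mod_cast sub_nonneg.2 hc1)
    have h2 : ((c : ℂ) • (1 - Q)).PosSemidef := hQ1.smul (by exact_mod_cast hc0.le)
    have e : (1 - (c : ℂ) • Q) = ((1 - c : ℝ) : ℂ) • (1 : Matrix ι ι ℂ) + (c : ℂ) • (1 - Q) := by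
      push_cast
      module
    rw [e]
    exact h1.add h2
  have hmul : ∀ τ : Matrix ι ι ℂ, ((c : ℂ) • Q * τ).trace.re = c * (Q * τ).trace.re := fun τ => by
    rw [smul_mul_assoc, Matrix.trace_smul, smul_eq_mul, Complex.re_ofReal_mul]
  obtain ⟨hz, hle⟩ := binary_relEnt_le hcQ hcQ1 hρ hσ hs ((hmul ρ).trans hcp) (hmul σ)
  rw [← hq] at hz hle
  have hq0 : 0 < q := by
    refine lt_of_le_of_ne (trace_mul_re_nonneg hQ hσ.1) fun h => ?_
    have := hz (by rw [← h, mul_zero])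
    linarith
  have hcq1 : 0 ≤ 1 - c * q := by
    have := trace_mul_re_nonneg hcQ1 hσ.1
    rwa [trace_one_sub_mul hσ, hmul] at this
  refine ⟨hq0, ?_⟩
  have hl1 : Real.log (c * q) ≤ Real.log q :=
    Real.log_le_log (mul_pos hc0 hq0) (mul_le_of_le_one_left hq0.le hc1)
  have hl2 : Real.log (1 - c * q) ≤ 0 :=
    Real.log_nonpos hcq1 (by linarith [mul_pos hc0 hq0])
  rw [sub_sub_cancel] at hle
  have hfin : (1 - ε) * -Real.log q ≤
      D * Real.log 2 + (-(ε * Real.log ε) - (1 - ε) * Real.log (1 - ε)) := by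
    have h1 := mul_le_mul_of_nonneg_left hl1 (sub_nonneg.2 hε1.le)
    have h2 := mul_nonneg hε0 (neg_nonneg.2 hl2)
    linarith
  calc (1 - ε) * -Real.logb 2 q = (1 - ε) * -Real.log q / Real.log 2 := by
        rw [Real.logb]; ring
    _ ≤ (D * Real.log 2 + (-(ε * Real.log ε) - (1 - ε) * Real.log (1 - ε))) / Real.log 2 :=
        div_le_div_of_nonneg_right hfin hlog2.le
    _ = D + h2 ε := by
        rw [h2, Real.logb, Real.logb]
        field_simp

end Adaptive

/-- Weak converse in the Stein setting: for an `n = m + 1`-round adaptive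
protocol with type I error at most `ε`,
`−(1/n) log₂ β_n ≤ (1/(1−ε)) (D^𝒜(N‖M) + h₂(ε)/n)`. -/
theorem stein_weak_converse
    {ι κ : Type} [Fintype ι] [DecidableEq ι] [Fintype κ] [DecidableEq κ]
    (N M : Matrix ι ι ℂ → Matrix κ κ ℂ) (hN : IsChannel N) (hM : IsChannel M)
    (m : ℕ) (ε : ℝ) (hε0 : 0 ≤ ε) (hε1 : ε < 1)
    (P : Protocol ι κ m) (hα : P.typeI N ≤ ε) :
    (((m + 1 : ℝ))⁻¹ : EReal) * negLog2 (P.typeII M) ≤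
      (((1 - ε)⁻¹ : ℝ) : EReal) *
        (amortizedDiv relEntFam N M + ((h2 ε / (m + 1 : ℝ) : ℝ) : EReal)) := by
  induction hA : amortizedDiv relEntFam N M using EReal.rec with
  | bot => exact absurd hA (amortizedDiv_ne_bot N M P.init_density)
  | top =>
    rw [EReal.top_add_coe, EReal.coe_mul_top_of_pos (inv_pos.2 (sub_pos.2 hε1))]
    exact le_top
  | coe a =>
    obtain ⟨hβ, hle⟩ := neg_log_le_of_relEnt_le P.meas_psd P.meas_le_one (P.isDensity_final hN)
      (P.isDensity_final hM) (P.relEnt_final_le hN hM hA) hε0 hε1 hα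
    change 0 < P.typeII M at hβ
    have hm : (0 : ℝ) < m + 1 := by positivity
    rw [negLog2, if_neg (not_le.2 hβ), ← EReal.coe_inv, ← EReal.coe_mul, ← EReal.coe_add,
      ← EReal.coe_mul, EReal.coe_le_coe_iff, inv_mul_le_iff₀ hm, mul_left_comm,
      le_inv_mul_iff₀ (sub_pos.2 hε1), mul_add, mul_div_cancel₀ _ hm.ne']
    exact hle

end
end
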